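/- arXiv:2601.12590 — 3 statements merged into one kernel-verified Lean document; each statement's English description precedes it below -/
import Mathlib

section
/- Let a > 0 be real. Then ∫₀^∞ x K_{1/3}⁴(a x) dx = (π²/(4a²)) ln 3. -/
open MeasureTheory Real

noncomputable def besselK (ν x : ℝ) : ℝ :=
  ∫ t in Set.Ioi (0:ℝ), Real.exp (-x * Real.cosh t) * Real.cosh (ν * t)

section

open Set Filter Topology
open scoped ENNReal

/-- The fundamental theorem of calculus on a half-line, for a nonnegative derivative. -/
theorem lintegral_Ioi_of_hasDerivAt {g g' : ℝ → ℝ} {a l : ℝ}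
    (hcont : ContinuousWithinAt g (Ici a) a) (hderiv : ∀ x ∈ Ioi a, HasDerivAt g (g' x) x)
    (hpos : ∀ x ∈ Ioi a, 0 ≤ g' x) (hg : Tendsto g atTop (𝓝 l)) :
    ∫⁻ x in Ioi a, ENNReal.ofReal (g' x) = ENNReal.ofReal (l - g a) := by
  rw [← integral_Ioi_of_hasDerivAt_of_nonneg hcont hderiv hpos hg,
    ofReal_integral_eq_lintegral_ofReal
      (integrableOn_Ioi_deriv_of_nonneg hcont hderiv hpos hg)]
  exact (ae_restrict_iff' measurableSet_Ioi).2 (ae_of_all _ hpos)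

theorem lintegral_eq_add_lintegral_Ioi (f : ℝ → ℝ≥0∞) :
    ∫⁻ x, f x = (∫⁻ x in Ioi 0, f x) + ∫⁻ x in Ioi 0, f (-x) := by
  have h : ∫⁻ x in Ioi (0:ℝ), f (-x) = ∫⁻ x in Iio 0, f x := by
    have := (Measure.measurePreserving_neg (volume : Measure ℝ)).setLIntegral_comp_preimage_emb
      (Homeomorph.neg ℝ).measurableEmbedding f (Iio 0)
    simpa using this
  rw [h, ← setLIntegral_univ, ← Iic_union_Ioi (a := (0:ℝ)),
    lintegral_union measurableSet_Ioi (Iic_disjoint_Ioi le_rfl), add_comm,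
    setLIntegral_congr Iio_ae_eq_Iic]

theorem lintegral_eq_two_mul_of_even {f : ℝ → ℝ≥0∞} (hf : ∀ x, f (-x) = f x) :
    ∫⁻ x, f x = 2 * ∫⁻ x in Ioi 0, f x := by
  simp_rw [lintegral_eq_add_lintegral_Ioi f, hf, two_mul]

/-- The fundamental theorem of calculus on the line, for a nonnegative derivative. -/
theorem lintegral_of_hasDerivAt {g g' : ℝ → ℝ} {m l : ℝ}
    (hderiv : ∀ x, HasDerivAt g (g' x) x) (hpos : ∀ x, 0 ≤ g' x)
    (hbot : Tendsto g atBot (𝓝 m)) (htop : Tendsto g atTop (𝓝 l)) :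
    ∫⁻ x, ENNReal.ofReal (g' x) = ENNReal.ofReal (l - m) := by
  have hmono : Monotone g := monotone_of_deriv_nonneg (fun x => (hderiv x).differentiableAt)
    (fun x => by rw [(hderiv x).deriv]; exact hpos x)
  have h2 : ∀ x, HasDerivAt (fun y => -g (-y)) (g' (-x)) x := fun x => by
    have := ((hderiv (-x)).comp x (hasDerivAt_neg x)).neg
    simpa [Function.comp_def] using! this
  rw [lintegral_eq_add_lintegral_Ioi, lintegral_Ioi_of_hasDerivAt (g := g) (l := l)
    (hderiv 0).continuousAt.continuousWithinAt (fun x _ => hderiv x) (fun x _ => hpos x) htop,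
    lintegral_Ioi_of_hasDerivAt (g := fun y => -g (-y)) (l := -m)
    (h2 0).continuousAt.continuousWithinAt (fun x _ => h2 x) (fun x _ => hpos _)
    (hbot.comp tendsto_neg_atTop_atBot).neg, ← ENNReal.ofReal_add]
  · congr 1; simp; ring
  · simpa using hmono.ge_of_tendsto htop 0
  · simpa using hmono.le_of_tendsto hbot 0

/-- Lebesgue measure on the line in the logarithmic coordinate `s = 6 log z`. -/
theorem lintegral_eq_lintegral_comp_log (f : ℝ → ℝ≥0∞) :
    ∫⁻ s, f s = ∫⁻ z in Ioi 0, ENNReal.ofReal (6 / z) * f (6 * log z) := by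
  have him : (fun z => 6 * log z) '' Ioi 0 = univ := by
    refine eq_univ_of_forall fun s => ⟨exp (s / 6), exp_pos _, ?_⟩
    simp only [log_exp]; ring
  rw [← setLIntegral_univ, ← him, lintegral_image_eq_lintegral_abs_deriv_mul measurableSet_Ioi
    (f' := fun z => 6 / z)]
  · refine setLIntegral_congr_fun measurableSet_Ioi fun z hz => ?_
    simp only [abs_of_pos (div_pos (by norm_num : (0:ℝ) < 6) hz)]
  · intro z hz
    have := ((hasDerivAt_log (ne_of_gt hz)).const_mul 6).hasDerivWithinAt (s := Ioi 0)
    simpa [div_eq_mul_inv] using this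
  · intro x hx y hy h
    exact log_injOn_pos hx hy (by simpa using h)

theorem hasDerivAt_cubic_antideriv {ρ z : ℝ} (hρ : 0 < ρ) (hz : 0 < z + ρ) :
    HasDerivAt (fun z => (1 / 6 * log ((z ^ 2 - z * ρ + ρ ^ 2) / (z + ρ) ^ 2)
      + arctan ((2 * z - ρ) / (ρ * √3)) / √3) / ρ) (z / (z ^ 3 + ρ ^ 3)) z := by
  have h3 : √3 ^ 2 = 3 := sq_sqrt (by norm_num)
  have h3p : 0 < √3 := by positivity
  have hq : 0 < z ^ 2 - z * ρ + ρ ^ 2 := by nlinarith [sq_nonneg (z - ρ / 2)]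
  have hc : z ^ 3 + ρ ^ 3 = (z + ρ) * (z ^ 2 - z * ρ + ρ ^ 2) := by ring
  have hid := hasDerivAt_id z
  have e1 : HasDerivAt (fun z => (z ^ 2 - z * ρ + ρ ^ 2) / (z + ρ) ^ 2) _ z :=
    ((((hid.pow 2).sub (hid.mul_const ρ)).add_const (ρ ^ 2))).div ((hid.add_const ρ).pow 2)
      (by simpa using hz.ne')
  have e2 : HasDerivAt (fun z => (2 * z - ρ) / (ρ * √3)) _ z :=
    ((hid.const_mul 2).sub_const ρ).div_const (ρ * √3)
  have e := (((e1.log (by positivity)).const_mul (1 / 6)).add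
    (e2.arctan.div_const √3)).div_const ρ
  refine e.congr_deriv ?_
  have h4 : 1 + ((2 * z - ρ) / (ρ * √3)) ^ 2 = 4 * (z ^ 2 - z * ρ + ρ ^ 2) / (3 * ρ ^ 2) := by
    rw [div_pow, mul_pow, h3]; field_simp; ring
  simp only [id, Pi.sub_apply, Pi.pow_apply]
  rw [h4, hc]
  field_simp
  rw [h3]
  ring

theorem tendsto_cubic_antideriv {ρ : ℝ} (hρ : 0 < ρ) :
    Tendsto (fun z => (1 / 6 * log ((z ^ 2 - z * ρ + ρ ^ 2) / (z + ρ) ^ 2)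
      + arctan ((2 * z - ρ) / (ρ * √3)) / √3) / ρ) atTop (𝓝 (π / 2 / √3 / ρ)) := by
  have hl : Tendsto (fun z : ℝ => (z ^ 2 - z * ρ + ρ ^ 2) / (z + ρ) ^ 2) atTop (𝓝 1) := by
    have hi := tendsto_inv_atTop_zero (𝕜 := ℝ)
    have : Tendsto (fun z : ℝ => (1 - z⁻¹ * ρ + (z⁻¹ * ρ) ^ 2) / (1 + z⁻¹ * ρ) ^ 2) atTop
        (𝓝 ((1 - 0 * ρ + (0 * ρ) ^ 2) / (1 + 0 * ρ) ^ 2)) := by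
      have h := hi.mul_const ρ
      exact ((tendsto_const_nhds.sub h).add (h.pow 2)).div ((tendsto_const_nhds.add h).pow 2)
        (by simp)
    simp only [zero_mul, sub_zero, add_zero, one_pow, div_one, ne_eq, OfNat.ofNat_ne_zero,
      not_false_eq_true, zero_pow] at this
    refine this.congr' ?_
    filter_upwards [eventually_gt_atTop 0] with z hz
    have : 0 < z + ρ := by positivity
    field_simp
  have ha : Tendsto (fun z : ℝ => (2 * z - ρ) / (ρ * √3)) atTop atTop :=
    (tendsto_atTop_add_const_right _ (-ρ)
      (tendsto_id.const_mul_atTop (by norm_num : (0:ℝ) < 2))).atTop_div_const (by positivity)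
  have := (((hl.log one_ne_zero).const_mul (1 / 6)).add
    ((tendsto_nhds_of_tendsto_nhdsWithin (tendsto_arctan_atTop.comp ha)).div_const √3)).div_const ρ
  simpa using this

theorem cubic_antideriv_zero {ρ : ℝ} (hρ : 0 < ρ) :
    (1 / 6 * log (((0:ℝ) ^ 2 - 0 * ρ + ρ ^ 2) / (0 + ρ) ^ 2)
      + arctan ((2 * 0 - ρ) / (ρ * √3)) / √3) / ρ = - (π / 6) / √3 / ρ := by
  have h1 : ((0:ℝ) ^ 2 - 0 * ρ + ρ ^ 2) / (0 + ρ) ^ 2 = 1 := by field_simp; ring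
  have h2 : (2 * 0 - ρ) / (ρ * √3) = - (√3)⁻¹ := by field_simp; ring
  rw [h1, h2, arctan_neg, arctan_inv_sqrt_three]; simp

theorem lintegral_cubic {ρ : ℝ} (hρ : 0 < ρ) (h1 : ρ ≠ 1) :
    ∫⁻ z in Ioi 0, ENNReal.ofReal (6 * z / (ρ ^ 3 + (ρ ^ 3)⁻¹ + z ^ 3 + (z ^ 3)⁻¹))
      = ENNReal.ofReal (4 * π / √3 * (ρ * (ρ ^ 2 + 1) / (ρ ^ 4 + ρ ^ 2 + 1))) := by
  have hρ' : 0 < ρ⁻¹ := by positivity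
  have hs : ρ ^ 6 - 1 ≠ 0 := by
    have : ρ ^ 6 ≠ 1 := by rwa [Ne, pow_eq_one_iff_of_nonneg hρ.le (by norm_num)]
    exact sub_ne_zero.2 this
  have hs' : ρ ^ 3 - (ρ ^ 3)⁻¹ ≠ 0 := by
    have : ρ ^ 3 - (ρ ^ 3)⁻¹ = (ρ ^ 6 - 1) / ρ ^ 3 := by field_simp
    rw [this]; positivity
  have hd : ∀ z : ℝ, 0 ≤ z → HasDerivAt (fun z => 6 / (ρ ^ 3 - (ρ ^ 3)⁻¹) *
      (ρ ^ 3 * ((1 / 6 * log ((z ^ 2 - z * ρ + ρ ^ 2) / (z + ρ) ^ 2)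
      + arctan ((2 * z - ρ) / (ρ * √3)) / √3) / ρ) - (ρ⁻¹) ^ 3 *
      ((1 / 6 * log ((z ^ 2 - z * ρ⁻¹ + ρ⁻¹ ^ 2) / (z + ρ⁻¹) ^ 2)
      + arctan ((2 * z - ρ⁻¹) / (ρ⁻¹ * √3)) / √3) / ρ⁻¹)))
      (6 / (ρ ^ 3 - (ρ ^ 3)⁻¹) * (ρ ^ 3 * (z / (z ^ 3 + ρ ^ 3)) -
        (ρ⁻¹) ^ 3 * (z / (z ^ 3 + ρ⁻¹ ^ 3)))) z := fun z hz =>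
    (((hasDerivAt_cubic_antideriv hρ (by positivity)).const_mul _).sub
      ((hasDerivAt_cubic_antideriv hρ' (by positivity)).const_mul _)).const_mul _
  have he : ∀ z ∈ Ioi (0:ℝ), 6 * z / (ρ ^ 3 + (ρ ^ 3)⁻¹ + z ^ 3 + (z ^ 3)⁻¹) =
      6 / (ρ ^ 3 - (ρ ^ 3)⁻¹) * (ρ ^ 3 * (z / (z ^ 3 + ρ ^ 3)) -
        (ρ⁻¹) ^ 3 * (z / (z ^ 3 + ρ⁻¹ ^ 3))) := by
    intro z hz
    have hz : 0 < z := hz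
    have e1 : ρ ^ 3 + (ρ ^ 3)⁻¹ + z ^ 3 + (z ^ 3)⁻¹
      = (z ^ 3 + ρ ^ 3) * (z ^ 3 * ρ ^ 3 + 1) / (z ^ 3 * ρ ^ 3) := by
      field_simp; ring
    have e2 : z ^ 3 + ρ⁻¹ ^ 3 = (z ^ 3 * ρ ^ 3 + 1) / ρ ^ 3 := by field_simp
    have e3 : ρ ^ 3 - (ρ ^ 3)⁻¹ = (ρ ^ 6 - 1) / ρ ^ 3 := by field_simp
    rw [e1, e2, e3]
    have : 0 < z ^ 3 + ρ ^ 3 := by positivity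
    have : 0 < z ^ 3 * ρ ^ 3 + 1 := by positivity
    field_simp
    ring
  rw [setLIntegral_congr_fun measurableSet_Ioi (fun z hz => by rw [he z hz]),
    lintegral_Ioi_of_hasDerivAt (hd 0 le_rfl).continuousAt.continuousWithinAt
    (fun z hz => hd z (le_of_lt hz)) (fun z hz => by
      rw [← he z hz]; have : (0:ℝ) < z := hz; positivity)
    ((((tendsto_cubic_antideriv hρ).const_mul _).sub
      ((tendsto_cubic_antideriv hρ').const_mul _)).const_mul _),
    cubic_antideriv_zero hρ, cubic_antideriv_zero hρ']
  congr 1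
  have e3 : ρ ^ 3 - (ρ ^ 3)⁻¹ = (ρ ^ 6 - 1) / ρ ^ 3 := by field_simp
  rw [e3]
  have : 0 < ρ ^ 4 + ρ ^ 2 + 1 := by positivity
  field_simp
  ring

/-- The inner integral, over the difference of the hyperbolic angles. -/
theorem lintegral_exp_div_cosh {ρ : ℝ} (hρ : 0 < ρ) (h1 : ρ ≠ 1) :
    ∫⁻ s, ENNReal.ofReal (exp (s / 3) / (ρ ^ 3 + (ρ ^ 3)⁻¹ + 2 * cosh (s / 2)))
      = ENNReal.ofReal (4 * π / √3 * (ρ * (ρ ^ 2 + 1) / (ρ ^ 4 + ρ ^ 2 + 1))) := by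
  rw [lintegral_eq_lintegral_comp_log, ← lintegral_cubic hρ h1]
  refine setLIntegral_congr_fun measurableSet_Ioi fun z hz => ?_
  have hz : 0 < z := hz
  have e1 : exp (6 * log z / 3) = z ^ 2 := by
    rw [show 6 * log z / 3 = ((2 : ℕ) : ℝ) * log z by push_cast; ring, exp_nat_mul, exp_log hz]
  have e2 : 2 * cosh (6 * log z / 2) = z ^ 3 + (z ^ 3)⁻¹ := by
    rw [cosh_eq, exp_neg, show 6 * log z / 2 = ((3 : ℕ) : ℝ) * log z by push_cast; ring,
      exp_nat_mul, exp_log hz]; ring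
  rw [← ENNReal.ofReal_mul (by positivity)]
  congr 1
  rw [e1, e2, ← add_assoc]
  field_simp

theorem tendsto_real_cosh_atTop : Tendsto cosh atTop atTop := by
  refine tendsto_atTop_mono (fun x => ?_) (tendsto_exp_atTop.atTop_div_const (zero_lt_two' ℝ))
  rw [cosh_eq]
  have := exp_pos (-x)
  linarith

theorem tendsto_log_sinh_add_sqrt {r : ℝ} (hr : 0 < r) :
    Tendsto (fun u => log (sinh u + √(r ^ 2 * cosh u ^ 2 - 1)) - log (cosh u)) atTop
      (𝓝 (log (1 + r))) := by
  have h1 : Tendsto (fun c : ℝ => log (√(1 - c⁻¹ ^ 2) + √(r ^ 2 - c⁻¹ ^ 2))) atTop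
      (𝓝 (log (√(1 - 0 ^ 2) + √(r ^ 2 - 0 ^ 2)))) := by
    have hi := (tendsto_inv_atTop_zero (𝕜 := ℝ)).pow 2
    refine ((tendsto_const_nhds.sub hi).sqrt.add (tendsto_const_nhds.sub hi).sqrt).log ?_
    simp only [ne_eq, OfNat.ofNat_ne_zero, not_false_eq_true, zero_pow, sub_zero, sqrt_one,
      sqrt_sq hr.le]
    positivity
  simp only [ne_eq, OfNat.ofNat_ne_zero, not_false_eq_true, zero_pow, sub_zero, sqrt_one,
    sqrt_sq hr.le] at h1
  refine (h1.comp tendsto_real_cosh_atTop).congr' ?_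
  filter_upwards [eventually_gt_atTop 0] with u hu
  have hs := sinh_pos_iff.2 hu
  have hc := cosh_pos u
  have e1 : √(1 - (cosh u)⁻¹ ^ 2) = sinh u / cosh u := by
    rw [← sqrt_sq (div_pos hs hc).le]
    congr 1
    field_simp
    linarith [cosh_sq u]
  have e2 : √(r ^ 2 - (cosh u)⁻¹ ^ 2) = √(r ^ 2 * cosh u ^ 2 - 1) / cosh u := by
    rw [show r ^ 2 - (cosh u)⁻¹ ^ 2 = (r ^ 2 * cosh u ^ 2 - 1) / cosh u ^ 2 by field_simp,
      sqrt_div' _ (by positivity), sqrt_sq hc.le]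
  rw [Function.comp_apply, e1, e2, ← add_div, log_div (by positivity) hc.ne']

theorem hasDerivAt_log_sinh_add_sqrt {r u : ℝ} (hu : 0 < u) (h : 1 < r * cosh u) :
    HasDerivAt (fun u => log (sinh u + √(r ^ 2 * cosh u ^ 2 - 1)) - log (cosh u))
      (1 / (cosh u * √(r ^ 2 * cosh u ^ 2 - 1))) u := by
  have hs := sinh_pos_iff.2 hu
  have hc := cosh_pos u
  have hp : 0 < r ^ 2 * cosh u ^ 2 - 1 := by nlinarith
  have hR : √(r ^ 2 * cosh u ^ 2 - 1) ^ 2 = r ^ 2 * cosh u ^ 2 - 1 := sq_sqrt hp.le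
  have hRp : 0 < √(r ^ 2 * cosh u ^ 2 - 1) := sqrt_pos.2 hp
  have e := (((hasDerivAt_sinh u).add
    (((((hasDerivAt_cosh u).pow 2).const_mul (r ^ 2)).sub_const 1).sqrt hp.ne')).log
      (by simpa using (by positivity))).sub ((hasDerivAt_cosh u).log hc.ne')
  refine e.congr_deriv ?_
  simp only [Pi.add_apply, Pi.pow_apply]
  generalize √(r ^ 2 * cosh u ^ 2 - 1) = R at *
  have := cosh_sq u
  generalize cosh u = c at *
  generalize sinh u = s at *
  field_simp
  have h2 : c ^ 2 * r ^ 2 = R ^ 2 + 1 := by linarith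
  push_cast
  simp only [pow_one]
  linear_combination 2 * R * this + 2 * s * h2

theorem setLIntegral_Ioi_of_le {f : ℝ → ℝ≥0∞} {a b : ℝ} (hab : a ≤ b)
    (hf : ∀ x, a < x → x ≤ b → f x = 0) :
    ∫⁻ x in Ioi a, f x = ∫⁻ x in Ioi b, f x := by
  rw [← Ioc_union_Ioi_eq_Ioi hab, lintegral_union measurableSet_Ioi Ioc_disjoint_Ioi_same,
    setLIntegral_congr_fun measurableSet_Ioc (g := 0) (fun x hx => hf x hx.1 hx.2)]
  simp

theorem lintegral_inv_cosh_mul_sqrt {r : ℝ} (hr : 0 < r) (h1 : r ≠ 1) :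
    ∫⁻ u in Ioi 0, ENNReal.ofReal (1 / (cosh u * √(r ^ 2 * cosh u ^ 2 - 1)))
      = ENNReal.ofReal (1 / 2 * log ((1 + r) / (1 - r))) := by
  obtain ⟨u₀, hu₀, hlt, hle, hne, hval⟩ : ∃ u₀ : ℝ, 0 ≤ u₀ ∧ (∀ u, u₀ < u → 1 < r * cosh u) ∧
      (∀ u, 0 < u → u ≤ u₀ → r * cosh u ≤ 1) ∧ sinh u₀ + √(r ^ 2 * cosh u₀ ^ 2 - 1) ≠ 0 ∧
      log (sinh u₀ + √(r ^ 2 * cosh u₀ ^ 2 - 1)) - log (cosh u₀) = 1 / 2 * log (1 - r ^ 2) := by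
    rcases h1.lt_or_gt with h | h
    · have hr1 : 1 < r⁻¹ := (one_lt_inv₀ hr).2 h
      have hpos : 0 < arcosh r⁻¹ := arcosh_pos hr1
      have hc : cosh (arcosh r⁻¹) = r⁻¹ := cosh_arcosh hr1.le
      have hR : r ^ 2 * cosh (arcosh r⁻¹) ^ 2 - 1 = 0 := by rw [hc]; field_simp; simp
      have hs := sinh_pos_iff.2 hpos
      refine ⟨arcosh r⁻¹, hpos.le, fun u hu => ?_, fun u hu hu' => ?_, ?_, ?_⟩
      · have : r⁻¹ < cosh u := by
          rw [← hc, cosh_lt_cosh, abs_of_pos hpos, abs_of_pos (hpos.trans hu)]; exact hu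
        rwa [inv_lt_iff_one_lt_mul₀' hr] at this
      · have : cosh u ≤ r⁻¹ := by
          rw [← hc, cosh_le_cosh, abs_of_pos hpos, abs_of_pos hu]; exact hu'
        rwa [le_inv_comm₀ (cosh_pos u) hr, ← one_div, le_div_iff₀ (cosh_pos u)] at this
      · rw [hR, sqrt_zero, add_zero]; exact hs.ne'
      · have h3 : sinh (arcosh r⁻¹) ^ 2 = (1 - r ^ 2) / r ^ 2 := by
          rw [sinh_sq, hc]; field_simp
        have h4 : 2 * log (sinh (arcosh r⁻¹)) = log (1 - r ^ 2) - 2 * log r := by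
          have := congrArg log h3
          rw [log_pow, log_div (by nlinarith) (by positivity), log_pow] at this
          exact_mod_cast this
        rw [hR, sqrt_zero, add_zero, hc, log_inv]
        linarith
    · refine ⟨0, le_rfl, fun u hu => ?_, fun u hu hu' => absurd hu' hu.not_ge, ?_, ?_⟩
      · have := one_lt_cosh.2 hu.ne'
        nlinarith
      · simp only [sinh_zero, cosh_zero, zero_add, one_pow, mul_one]
        exact (sqrt_pos.2 (by nlinarith)).ne'
      · simp only [sinh_zero, cosh_zero, zero_add, one_pow, mul_one, log_one, sub_zero]
        rw [log_sqrt (by nlinarith), ← neg_sub, log_neg_eq_log]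
        ring
  rw [setLIntegral_Ioi_of_le hu₀, lintegral_Ioi_of_hasDerivAt
    (g := fun u => log (sinh u + √(r ^ 2 * cosh u ^ 2 - 1)) - log (cosh u)) _
    (fun u hu => hasDerivAt_log_sinh_add_sqrt (hu₀.trans_lt hu) (hlt u hu))
    (fun u _ => by have := cosh_pos u; positivity) (tendsto_log_sinh_add_sqrt hr), hval]
  · congr 1
    have h2 : 1 - r ≠ 0 := sub_ne_zero.2 h1.symm
    rw [log_div (by positivity) h2, show 1 - r ^ 2 = (1 + r) * (1 - r) by ring,
      log_mul (by positivity) h2]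
    ring
  · refine ContinuousAt.continuousWithinAt ?_
    exact ((continuous_sinh.add (by fun_prop)).continuousAt.log hne).sub
      (continuous_cosh.continuousAt.log (cosh_pos u₀).ne')
  · intro u hu hu'
    have := hle u hu hu'
    have hc := cosh_pos u
    rw [sqrt_eq_zero_of_nonpos (by nlinarith [mul_pos hr hc])]
    simp

theorem lintegral_cosh_div {Q : ℝ} (hQ : 0 < Q) (H : ℝ → ℝ≥0∞) :
    ∫⁻ u in Ioi 0, ENNReal.ofReal (1 / cosh u) * H (cosh u / Q)
      = ∫⁻ r in Ioi 0, ENNReal.ofReal (1 / (r * √(r ^ 2 * Q ^ 2 - 1))) * H r := by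
  have him : (fun u => cosh u / Q) '' Ioi 0 = Ioi (1 / Q) := by
    ext r
    simp only [mem_image, mem_Ioi]
    constructor
    · rintro ⟨u, hu, rfl⟩
      exact div_lt_div_of_pos_right (one_lt_cosh.2 hu.ne') hQ
    · intro hr
      rw [div_lt_iff₀ hQ] at hr
      exact ⟨arcosh (r * Q), arcosh_pos hr, by rw [cosh_arcosh hr.le]; field_simp⟩
  symm
  rw [setLIntegral_Ioi_of_le (a := 0) (b := 1 / Q) (by positivity), ← him,
    lintegral_image_eq_lintegral_abs_deriv_mul measurableSet_Ioi
    (fun u _ => ((hasDerivAt_cosh u).div_const Q).hasDerivWithinAt)]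
  · refine setLIntegral_congr_fun measurableSet_Ioi fun u hu => ?_
    have hs := sinh_pos_iff.2 hu
    have hc := cosh_pos u
    have : √((cosh u / Q) ^ 2 * Q ^ 2 - 1) = sinh u := by
      rw [← sqrt_sq hs.le, sinh_sq]; congr 1; field_simp
    rw [this, ← mul_assoc, ← ENNReal.ofReal_mul (by positivity),
      abs_of_pos (by positivity)]
    congr 2
    field_simp
  · intro u hu v hv h
    have h : cosh u = cosh v := by simpa [hQ.ne'] using h
    have hu : 0 < u := hu
    have hv : 0 < v := hv
    refine le_antisymm ?_ ?_
    · have := cosh_le_cosh.1 h.le; rwa [abs_of_pos hu, abs_of_pos hv] at this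
    · have := cosh_le_cosh.1 h.ge; rwa [abs_of_pos hu, abs_of_pos hv] at this
  · intro r hr hr'
    rw [le_div_iff₀ hQ] at hr'
    rw [sqrt_eq_zero_of_nonpos (by nlinarith [mul_pos hr hQ])]
    simp

/-- The law of the ratio `cosh u / cosh v` under the measure `du dv / (cosh u cosh v)`. -/
theorem lintegral_lintegral_cosh_ratio {H : ℝ → ℝ≥0∞} (hH : Measurable H) :
    ∫⁻ v, ∫⁻ u, ENNReal.ofReal (1 / cosh v) * (ENNReal.ofReal (1 / cosh u) * H (cosh u / cosh v))
      = 4 * ∫⁻ r in Ioi 0, ENNReal.ofReal (1 / 2 * log ((1 + r) / (1 - r)))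
          * (ENNReal.ofReal (1 / r) * H r) := by
  have h1 : ∀ v : ℝ, ∫⁻ u, ENNReal.ofReal (1 / cosh v) *
      (ENNReal.ofReal (1 / cosh u) * H (cosh u / cosh v)) =
      2 * ∫⁻ r in Ioi 0, ENNReal.ofReal (1 / (cosh v * √(r ^ 2 * cosh v ^ 2 - 1))) *
        (ENNReal.ofReal (1 / r) * H r) := fun v => by
    rw [lintegral_const_mul _ (by fun_prop), lintegral_eq_two_mul_of_even (by simp),
      lintegral_cosh_div (cosh_pos v), mul_left_comm,
      ← lintegral_const_mul _ (by fun_prop)]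
    congr 1
    refine setLIntegral_congr_fun measurableSet_Ioi fun r hr => ?_
    have hr : 0 < r := hr
    have := cosh_pos v
    rw [← mul_assoc, ← mul_assoc, ← ENNReal.ofReal_mul (by positivity),
      ← ENNReal.ofReal_mul (by positivity)]
    congr 2
    field_simp
  simp_rw [h1]
  rw [lintegral_const_mul _ (by fun_prop), lintegral_eq_two_mul_of_even (by simp), ← mul_assoc,
    lintegral_lintegral_swap (by fun_prop)]
  congr 1
  · norm_num
  refine lintegral_congr_ae ?_
  filter_upwards [self_mem_ae_restrict measurableSet_Ioi,
    ae_restrict_of_ae (Measure.ae_ne volume (1:ℝ))] with r hr hr1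
  rw [lintegral_mul_const _ (by fun_prop), lintegral_inv_cosh_mul_sqrt hr hr1]
theorem lintegral_Ioo_of_hasDerivAt {g g' : ℝ → ℝ} {a b : ℝ} (hab : a ≤ b)
    (hcont : ContinuousOn g (Icc a b)) (hderiv : ∀ x ∈ Ioo a b, HasDerivAt g (g' x) x)
    (hpos : ∀ x ∈ Ioo a b, 0 ≤ g' x) :
    ∫⁻ x in Ioo a b, ENNReal.ofReal (g' x) = ENNReal.ofReal (g b - g a) := by
  have hint := intervalIntegral.integrableOn_deriv_of_nonneg hcont hderiv hpos
  rw [← intervalIntegral.integral_eq_sub_of_hasDerivAt_of_le hab hcont hderiv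
      ((intervalIntegrable_iff_integrableOn_Ioc_of_le hab).2 hint),
    intervalIntegral.integral_of_le hab, integral_Ioc_eq_integral_Ioo,
    ofReal_integral_eq_lintegral_ofReal (hint.mono_set Ioo_subset_Ioc_self)]
  exact (ae_restrict_iff' measurableSet_Ioo).2 (ae_of_all _ hpos)

theorem hasDerivAt_arctan_div_sqrt {A B c : ℝ} (hA : 0 < A) (hB : 0 ≤ B) (h : A = B + c ^ 2)
    (v : ℝ) : HasDerivAt (fun v => arctan (c * v / √(A + B * v ^ 2)))
      (c / ((1 + v ^ 2) * √(A + B * v ^ 2))) v := by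
  have hp : 0 < A + B * v ^ 2 := by positivity
  have hR : √(A + B * v ^ 2) ^ 2 = A + B * v ^ 2 := sq_sqrt hp.le
  have hRp := sqrt_pos.2 hp
  have hid := hasDerivAt_id v
  have e := ((hid.const_mul c).div ((((hid.pow 2).const_mul B).const_add A).sqrt hp.ne')
    hRp.ne').arctan
  refine e.congr_deriv ?_
  have hsum : 1 + (c * v / √(A + B * v ^ 2)) ^ 2 = A * (1 + v ^ 2) / (A + B * v ^ 2) := by
    rw [div_pow, hR]; field_simp; rw [h]; ring
  simp only [Pi.div_apply, Pi.pow_apply, id, hsum, hR]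
  generalize √(A + B * v ^ 2) = R at *
  field_simp
  rw [hR]
  push_cast
  ring

theorem tendsto_arctan_div_sqrt {A B : ℝ} (c : ℝ) (hB : 0 < B) :
    Tendsto (fun v => arctan (c * v / √(A + B * v ^ 2))) atTop (𝓝 (arctan (c / √B))) := by
  refine (continuous_arctan.tendsto _).comp ?_
  have h : Tendsto (fun v : ℝ => c / √(A * v⁻¹ ^ 2 + B)) atTop (𝓝 (c / √(A * 0 ^ 2 + B))) :=
    tendsto_const_nhds.div ((((tendsto_inv_atTop_zero (𝕜 := ℝ)).pow 2).const_mul A).add_const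
      B).sqrt (by simpa using (sqrt_pos.2 hB).ne')
  simp only [ne_eq, OfNat.ofNat_ne_zero, not_false_eq_true, zero_pow, mul_zero, zero_add] at h
  refine h.congr' ?_
  filter_upwards [eventually_gt_atTop 0] with v hv
  have : A + B * v ^ 2 = (A * v⁻¹ ^ 2 + B) * v ^ 2 := by field_simp
  rw [this, sqrt_mul' _ (by positivity), sqrt_sq hv.le]
  field_simp

theorem sub_div_sqrt_nonneg {x : ℝ} (hx : 0 < x) (v : ℝ) :
    0 ≤ 1 - (1 - x ^ 2) / √((1 + x ^ 2) ^ 2 + 4 * x ^ 2 * v ^ 2) := by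
  have hp : 0 < (1 + x ^ 2) ^ 2 + 4 * x ^ 2 * v ^ 2 := by positivity
  rw [sub_nonneg, div_le_one (sqrt_pos.2 hp)]
  refine le_sqrt_of_sq_le ?_
  nlinarith [sq_nonneg (x * v), sq_nonneg x]

theorem lintegral_sub_div_sqrt {x : ℝ} (hx : 0 < x) (hx1 : x < 1) :
    ∫⁻ v in Ioi 0, ENNReal.ofReal
      (1 / (1 + v ^ 2) * (1 / x * (1 - (1 - x ^ 2) / √((1 + x ^ 2) ^ 2 + 4 * x ^ 2 * v ^ 2))))
      = ENNReal.ofReal (2 * arctan x / x) := by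
  have hd : ∀ v, HasDerivAt (fun v => 1 / x * (arctan v -
      arctan ((1 - x ^ 2) * v / √((1 + x ^ 2) ^ 2 + 4 * x ^ 2 * v ^ 2))))
      (1 / (1 + v ^ 2) * (1 / x * (1 - (1 - x ^ 2) / √((1 + x ^ 2) ^ 2 + 4 * x ^ 2 * v ^ 2))))
      v := fun v => by
    refine (((hasDerivAt_arctan v).sub (hasDerivAt_arctan_div_sqrt (A := (1 + x ^ 2) ^ 2)
      (B := 4 * x ^ 2) (c := 1 - x ^ 2) (by positivity) (by positivity) (by ring) v)).const_mul
      (1 / x)).congr_deriv ?_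
    have hp : 0 < (1 + x ^ 2) ^ 2 + 4 * x ^ 2 * v ^ 2 := by positivity
    have := sqrt_pos.2 hp
    field_simp
  rw [lintegral_Ioi_of_hasDerivAt (hd 0).continuousAt.continuousWithinAt (fun v _ => hd v)
    (fun v _ => mul_nonneg (by positivity) (mul_nonneg (by positivity) (sub_div_sqrt_nonneg hx v)))
    (((tendsto_nhds_of_tendsto_nhdsWithin tendsto_arctan_atTop).sub
      (tendsto_arctan_div_sqrt (1 - x ^ 2) (by positivity))).const_mul (1 / x))]
  have hs : √(4 * x ^ 2) = 2 * x := by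
    rw [show 4 * x ^ 2 = (2 * x) ^ 2 by ring, sqrt_sq (by positivity)]
  have hy : 0 < 2 * x / (1 - x ^ 2) := div_pos (by positivity) (by nlinarith)
  have ha : arctan ((1 - x ^ 2) / (2 * x)) = π / 2 - 2 * arctan x := by
    rw [two_mul_arctan (by linarith) hx1, ← arctan_inv_of_pos hy, inv_div]
  rw [hs, ha]
  congr 1
  simp
  ring

theorem lintegral_two_div_sqrt {x : ℝ} (hx : 0 < x) :
    ∫⁻ v in Ioi 0, ENNReal.ofReal (1 / (1 + v ^ 2) * (2 / √(1 + v ^ 2 + x ^ 2)))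
      = ENNReal.ofReal (2 * arctan x / x) := by
  have hd : ∀ v, HasDerivAt (fun v => 2 / x * arctan (x * v / √(1 + x ^ 2 + 1 * v ^ 2)))
      (1 / (1 + v ^ 2) * (2 / √(1 + v ^ 2 + x ^ 2))) v := fun v => by
    refine ((hasDerivAt_arctan_div_sqrt (A := 1 + x ^ 2) (B := 1) (c := x) (by positivity)
      zero_le_one rfl v).const_mul (2 / x)).congr_deriv ?_
    rw [one_mul, add_right_comm]
    have hp : 0 < 1 + v ^ 2 + x ^ 2 := by positivity
    have := sqrt_pos.2 hp
    field_simp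
  rw [lintegral_Ioi_of_hasDerivAt (hd 0).continuousAt.continuousWithinAt (fun v _ => hd v)
    (fun v _ => by positivity) ((tendsto_arctan_div_sqrt x one_pos).const_mul (2 / x))]
  congr 1
  simp
  ring

theorem lintegral_Ioo_sub_div_sqrt {k v : ℝ} (hk : 0 < k) :
    ∫⁻ x in Ioo 0 k, ENNReal.ofReal
      (1 / x * (1 - (1 - x ^ 2) / √((1 + x ^ 2) ^ 2 + 4 * x ^ 2 * v ^ 2)))
      = ENNReal.ofReal (log ((1 + k ^ 2 + √((1 + k ^ 2) ^ 2 + 4 * k ^ 2 * v ^ 2)) / 2)) := by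
  have hp : ∀ x : ℝ, 0 < (1 + x ^ 2) ^ 2 + 4 * x ^ 2 * v ^ 2 := fun x => by positivity
  have hq : ∀ x : ℝ, 1 + x ^ 2 + √((1 + x ^ 2) ^ 2 + 4 * x ^ 2 * v ^ 2) ≠ 0 := fun x => by
    positivity
  rw [lintegral_Ioo_of_hasDerivAt hk.le
    (g := fun x => log (1 + x ^ 2 + √((1 + x ^ 2) ^ 2 + 4 * x ^ 2 * v ^ 2)))
    (Continuous.log (by fun_prop) hq).continuousOn (fun x hx => ?_)
    (fun x hx => mul_nonneg (one_div_nonneg.2 hx.1.le) (sub_div_sqrt_nonneg hx.1 v))]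
  · rw [log_div (hq k) two_ne_zero]
    norm_num
  · have hx0 : 0 < x := hx.1
    have hid := hasDerivAt_id x
    have e1 := (hid.pow 2).const_add 1
    have e := (e1.add (((e1.pow 2).add (((hid.pow 2).const_mul 4).mul_const
      (v ^ 2))).sqrt (hp x).ne')).log (hq x)
    refine e.congr_deriv ?_
    simp only [Pi.add_apply, Pi.pow_apply, id]
    have hR : √((1 + x ^ 2) ^ 2 + 4 * x ^ 2 * v ^ 2) ^ 2 = (1 + x ^ 2) ^ 2 + 4 * x ^ 2 * v ^ 2 :=
      sq_sqrt (hp x).le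
    have hRp := sqrt_pos.2 (hp x)
    generalize √((1 + x ^ 2) ^ 2 + 4 * x ^ 2 * v ^ 2) = R at *
    have : 0 < 1 + x ^ 2 + R := by positivity
    field_simp
    push_cast
    ring_nf
    ring_nf at hR
    linear_combination (-2) * hR

theorem lintegral_Ioo_two_div_sqrt {k v : ℝ} (hk : 0 < k) :
    ∫⁻ x in Ioo 0 k, ENNReal.ofReal (2 / √(1 + v ^ 2 + x ^ 2))
      = ENNReal.ofReal (log ((k + √(1 + v ^ 2 + k ^ 2)) ^ 2 / (1 + v ^ 2))) := by
  have hp : ∀ x : ℝ, 0 < 1 + v ^ 2 + x ^ 2 := fun x => by positivity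
  have hq : ∀ x : ℝ, 0 ≤ x → 0 < x + √(1 + v ^ 2 + x ^ 2) := fun x hx => by
    have := sqrt_pos.2 (hp x)
    positivity
  rw [lintegral_Ioo_of_hasDerivAt hk.le
    (g := fun x => 2 * log (x + √(1 + v ^ 2 + x ^ 2)))
    (ContinuousOn.const_mul (ContinuousOn.log (by fun_prop) (fun x hx => (hq x hx.1).ne')) 2)
    (fun x hx => ?_) (fun x hx => by positivity)]
  · rw [log_div (pow_pos (hq k hk.le) 2).ne' (by positivity), log_pow]
    simp only [ne_eq, OfNat.ofNat_ne_zero, not_false_eq_true, zero_pow, add_zero, zero_add]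
    rw [log_sqrt (by positivity)]
    push_cast
    congr 1
    ring
  · have hid := hasDerivAt_id x
    have e := ((hid.add (((hid.pow 2).const_add (1 + v ^ 2)).sqrt (hp x).ne')).log
      (hq x hx.1.le).ne').const_mul 2
    refine e.congr_deriv ?_
    have hRp := sqrt_pos.2 (hp x)
    have := hq x hx.1.le
    simp only [Pi.add_apply, Pi.pow_apply, id]
    generalize √(1 + v ^ 2 + x ^ 2) = R at *
    field_simp
    push_cast
    ring

/-- Both sides equal the integral of `2 arctan x / x` over `(0, k)`. -/
theorem lintegral_log_eq {k : ℝ} (hk : 0 < k) (hk1 : k < 1) :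
    ∫⁻ v in Ioi 0, ENNReal.ofReal
      (1 / (1 + v ^ 2) * log ((1 + k ^ 2 + √((1 + k ^ 2) ^ 2 + 4 * k ^ 2 * v ^ 2)) / 2))
    = ∫⁻ v in Ioi 0, ENNReal.ofReal
      (1 / (1 + v ^ 2) * log ((k + √(1 + v ^ 2 + k ^ 2)) ^ 2 / (1 + v ^ 2))) := by
  have hn : ∀ v : ℝ, 0 ≤ 1 / (1 + v ^ 2) := fun v => by positivity
  simp_rw [ENNReal.ofReal_mul (hn _), ← lintegral_Ioo_sub_div_sqrt hk,
    ← lintegral_Ioo_two_div_sqrt hk, ← lintegral_const_mul' _ _ ENNReal.ofReal_ne_top]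
  refine (lintegral_lintegral_swap (by fun_prop)).trans
    (Eq.trans ?_ (lintegral_lintegral_swap (by fun_prop)).symm)
  refine setLIntegral_congr_fun measurableSet_Ioo fun x hx => ?_
  simp_rw [← ENNReal.ofReal_mul (hn _)]
  rw [lintegral_sub_div_sqrt hx.1 (hx.2.trans hk1), lintegral_two_div_sqrt hx.1]

theorem integrableOn_log_div_one_add_sq :
    IntegrableOn (fun v => log v / (1 + v ^ 2)) (Ioi 0) := by
  have hm : Measurable fun v : ℝ => log v / (1 + v ^ 2) := by fun_prop
  rw [← Ioc_union_Ioi_eq_Ioi (zero_le_one' ℝ)]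
  refine IntegrableOn.union ?_ ?_
  · have h : IntegrableOn log (Ioc 0 1) :=
      (intervalIntegrable_iff_integrableOn_Ioc_of_le zero_le_one).1
        intervalIntegral.intervalIntegrable_log'
    refine Integrable.mono h hm.aestronglyMeasurable (ae_of_all _ fun v => ?_)
    rw [norm_div, norm_of_nonneg (by positivity : 0 ≤ 1 + v ^ 2)]
    exact div_le_self (norm_nonneg _) (by nlinarith [sq_nonneg v])
  · have h := (integrableOn_Ioi_rpow_of_lt (by norm_num : (-(3 / 2) : ℝ) < -1) one_pos).const_mul 2
    refine Integrable.mono' h hm.aestronglyMeasurable ?_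
    filter_upwards [self_mem_ae_restrict measurableSet_Ioi] with v hv
    have hv : 1 < v := hv
    have hv0 : 0 < v := by linarith
    rw [norm_of_nonneg (div_nonneg (log_nonneg hv.le) (by positivity))]
    have hl : log v ≤ 2 * v ^ (1 / 2 : ℝ) := by
      have := log_le_rpow_div hv0.le (by norm_num : (0:ℝ) < 1 / 2)
      linarith
    have he : 2 * v ^ (-(3 / 2) : ℝ) = 2 * v ^ (1 / 2 : ℝ) / v ^ 2 := by
      rw [mul_div_assoc, ← rpow_natCast v 2, ← rpow_sub hv0]; norm_num
    rw [he]
    have : 0 ≤ 2 * v ^ (1 / 2 : ℝ) := by positivity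
    gcongr
    linarith

theorem integral_log_div_one_add_sq : ∫ v in Ioi 0, log v / (1 + v ^ 2) = 0 := by
  have h := integral_comp_rpow_Ioi (fun v => log v / (1 + v ^ 2)) (p := -1) (by norm_num)
  have h2 : ∫ v in Ioi 0, (|(-1:ℝ)| * v ^ ((-1:ℝ) - 1)) •
      (log (v ^ (-1:ℝ)) / (1 + (v ^ (-1:ℝ)) ^ 2)) = - ∫ v in Ioi 0, log v / (1 + v ^ 2) := by
    rw [← integral_neg]
    refine setIntegral_congr_fun measurableSet_Ioi fun v hv => ?_
    have hv : 0 < v := hv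
    have e : v ^ ((-1:ℝ) - 1) = (v ^ 2)⁻¹ := by
      rw [show (-1:ℝ) - 1 = -((2:ℕ):ℝ) by norm_num, rpow_neg hv.le, rpow_natCast]
    simp only [e, rpow_neg_one, log_inv, smul_eq_mul, abs_neg, abs_one]
    field_simp
    ring
  linarith

theorem lintegral_log_mul_log :
    ∫⁻ v in Ioi 0, ENNReal.ofReal (1 / (1 + v ^ 2) * log ((2 + √(3 * v ^ 2 + 4)) / (√3 * v) *
      ((√(3 * v ^ 2 + 4) - 1) / (√(3 * v ^ 2 + 4) + 1)))) = ENNReal.ofReal (π / 4 * log 3) := by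
  have h3 : √3 ^ 2 = 3 := sq_sqrt (by norm_num)
  have h3p : 0 < √3 := by positivity
  have hk1 : 1 / √3 < 1 := by
    rw [div_lt_one h3p]; exact lt_sqrt_of_sq_lt (by norm_num)
  have hw : ∀ v : ℝ, √(3 * v ^ 2 + 4) ^ 2 = 3 * v ^ 2 + 4 := fun v => sq_sqrt (by positivity)
  have hw2 : ∀ v : ℝ, 2 ≤ √(3 * v ^ 2 + 4) := fun v => le_sqrt_of_sq_le (by nlinarith [sq_nonneg v])
  have key := lintegral_log_eq (k := 1 / √3) (by positivity) hk1
  have eA : ∀ v : ℝ, (1 + (1 / √3) ^ 2 + √((1 + (1 / √3) ^ 2) ^ 2 + 4 * (1 / √3) ^ 2 * v ^ 2)) / 2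
      = (2 + √(3 * v ^ 2 + 4)) / 3 := fun v => by
    have h13 : (1 / √3) ^ 2 = 1 / 3 := by rw [div_pow, h3]; norm_num
    rw [h13, show (1 + 1 / 3) ^ 2 + 4 * (1 / 3) * v ^ 2 = (2 / 3) ^ 2 * (3 * v ^ 2 + 4) by ring,
      sqrt_mul (by positivity), sqrt_sq (by positivity)]
    ring
  have eB : ∀ v : ℝ, (1 / √3 + √(1 + v ^ 2 + (1 / √3) ^ 2)) ^ 2 / (1 + v ^ 2)
      = (√(3 * v ^ 2 + 4) + 1) / (√(3 * v ^ 2 + 4) - 1) := fun v => by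
    have e : √(1 + v ^ 2 + (1 / √3) ^ 2) = √(3 * v ^ 2 + 4) / √3 := by
      rw [← sqrt_div' _ (by norm_num)]; congr 1; rw [div_pow, h3]; ring
    rw [e]
    have := hw2 v
    have hv := hw v
    have h1 : 0 < √(3 * v ^ 2 + 4) - 1 := by linarith
    generalize √(3 * v ^ 2 + 4) = w at *
    rw [div_eq_div_iff (by positivity) h1.ne', ← add_div, div_pow, h3]
    linear_combination ((1 + w) / 3) * hv
  simp only [eA, eB] at key
  have hB3 : ∀ v : ℝ, (√(3 * v ^ 2 + 4) + 1) / (√(3 * v ^ 2 + 4) - 1) ≤ 3 := fun v => by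
    have := hw2 v
    rw [div_le_iff₀ (by linarith)]; linarith
  have hB1 : ∀ v : ℝ, 1 ≤ (√(3 * v ^ 2 + 4) + 1) / (√(3 * v ^ 2 + 4) - 1) := fun v => by
    have := hw2 v
    rw [le_div_iff₀ (by linarith)]; linarith
  have hA1 : ∀ v : ℝ, 1 ≤ (2 + √(3 * v ^ 2 + 4)) / 3 := fun v => by
    have := hw2 v
    rw [le_div_iff₀ (by norm_num)]; linarith
  have hcauchy : IntegrableOn (fun v : ℝ => 1 / (1 + v ^ 2)) (Ioi 0) := by
    simpa using integrable_inv_one_add_sq.integrableOn (s := Ioi (0:ℝ))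
  have iB : IntegrableOn (fun v : ℝ => 1 / (1 + v ^ 2) *
      log ((√(3 * v ^ 2 + 4) + 1) / (√(3 * v ^ 2 + 4) - 1))) (Ioi 0) := by
    refine Integrable.mono' (hcauchy.mul_const (log 3)) (by fun_prop) (ae_of_all _ fun v => ?_)
    rw [norm_of_nonneg (mul_nonneg (by positivity) (log_nonneg (hB1 v)))]
    have := log_le_log (by linarith [hB1 v]) (hB3 v)
    gcongr
  have nA : ∀ v : ℝ, 0 ≤ 1 / (1 + v ^ 2) * log ((2 + √(3 * v ^ 2 + 4)) / 3) := fun v =>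
    mul_nonneg (by positivity) (log_nonneg (hA1 v))
  have nB : ∀ v : ℝ, 0 ≤ 1 / (1 + v ^ 2) *
      log ((√(3 * v ^ 2 + 4) + 1) / (√(3 * v ^ 2 + 4) - 1)) := fun v =>
    mul_nonneg (by positivity) (log_nonneg (hB1 v))
  have iA : IntegrableOn (fun v : ℝ => 1 / (1 + v ^ 2) *
      log ((2 + √(3 * v ^ 2 + 4)) / 3)) (Ioi 0) := by
    refine ⟨by fun_prop, ?_⟩
    rw [hasFiniteIntegral_iff_ofReal (ae_of_all _ nA), key,
      ← hasFiniteIntegral_iff_ofReal (ae_of_all _ nB)]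
    exact iB.2
  have hAB : ∫ v in Ioi (0:ℝ), 1 / (1 + v ^ 2) * log ((2 + √(3 * v ^ 2 + 4)) / 3)
      = ∫ v in Ioi (0:ℝ), 1 / (1 + v ^ 2) *
        log ((√(3 * v ^ 2 + 4) + 1) / (√(3 * v ^ 2 + 4) - 1)) := by
    rw [integral_eq_lintegral_of_nonneg_ae (ae_of_all _ nA) iA.1,
      integral_eq_lintegral_of_nonneg_ae (ae_of_all _ nB) iB.1, key]
  have hdec : ∀ v ∈ Ioi (0:ℝ), 1 / (1 + v ^ 2) * log ((2 + √(3 * v ^ 2 + 4)) / (√3 * v) *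
      ((√(3 * v ^ 2 + 4) - 1) / (√(3 * v ^ 2 + 4) + 1)))
      = 1 / (1 + v ^ 2) * log ((2 + √(3 * v ^ 2 + 4)) / 3) - 1 / (1 + v ^ 2) *
        log ((√(3 * v ^ 2 + 4) + 1) / (√(3 * v ^ 2 + 4) - 1))
        + 1 / (1 + v ^ 2) * (log 3 / 2) - log v / (1 + v ^ 2) := by
    intro v hv
    have hv : v ≠ 0 := ne_of_gt hv
    have := hw2 v
    have a1 : 2 + √(3 * v ^ 2 + 4) ≠ 0 := by linarith
    have a2 : √(3 * v ^ 2 + 4) - 1 ≠ 0 := by linarith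
    have a3 : √(3 * v ^ 2 + 4) + 1 ≠ 0 := by linarith
    rw [log_mul (div_ne_zero a1 (mul_ne_zero h3p.ne' hv)) (div_ne_zero a2 a3),
      log_div a1 (mul_ne_zero h3p.ne' hv), log_mul h3p.ne' hv, log_div a2 a3, log_div a3 a2,
      log_div a1 three_ne_zero, log_sqrt (by norm_num)]
    ring
  have iC := hcauchy.mul_const (log 3 / 2)
  have hi : IntegrableOn (fun v : ℝ => 1 / (1 + v ^ 2) * log ((2 + √(3 * v ^ 2 + 4)) / 3)
      - 1 / (1 + v ^ 2) * log ((√(3 * v ^ 2 + 4) + 1) / (√(3 * v ^ 2 + 4) - 1))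
      + 1 / (1 + v ^ 2) * (log 3 / 2) - log v / (1 + v ^ 2)) (Ioi 0) :=
    ((iA.sub iB).add iC).sub integrableOn_log_div_one_add_sq
  rw [setLIntegral_congr_fun measurableSet_Ioi (fun v hv => by rw [hdec v hv]),
    ← ofReal_integral_eq_lintegral_ofReal hi]
  · congr 1
    have e1 := integral_sub ((iA.sub iB).add iC) integrableOn_log_div_one_add_sq
    have e2 := integral_add (iA.sub iB) iC
    have e3 := integral_sub iA iB
    simp only [Pi.sub_apply, Pi.add_apply] at e1 e2 e3
    rw [e1, e2, e3, hAB, integral_log_div_one_add_sq, integral_mul_const]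
    simp only [one_div, integral_Ioi_inv_one_add_sq, arctan_zero]
    ring
  · filter_upwards [self_mem_ae_restrict measurableSet_Ioi] with v hv
    rw [Pi.zero_apply, ← hdec v hv]
    have hv : 0 < v := hv
    refine mul_nonneg (by positivity) (log_nonneg ?_)
    have h2 := hw2 v
    have h4 := hw v
    rw [div_mul_div_comm, one_le_div (by positivity)]
    refine abs_le_of_sq_le_sq' ?_ (mul_nonneg (by linarith) (by linarith)) |>.2
    generalize √(3 * v ^ 2 + 4) = w at *
    have e : (√3 * v) ^ 2 = (w - 2) * (w + 2) := by rw [mul_pow, h3]; linarith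
    rw [mul_pow (√3 * v), e]
    nlinarith

theorem lintegral_div_quartic_mul_log :
    ∫⁻ q in Ioi 0, ENNReal.ofReal
      ((q ^ 2 + 1) / (q ^ 4 + q ^ 2 + 1) * log ((1 + q ^ 3) / (1 - q ^ 3)))
      = ENNReal.ofReal (2 / √3 * (π / 4 * log 3)) := by
  have h3 : √3 ^ 2 = 3 := sq_sqrt (by norm_num)
  have h3p : 0 < √3 := by positivity
  have him : (fun q : ℝ => (q - q⁻¹) / √3) '' Ioi 0 = univ := by
    refine eq_univ_of_forall fun v => ⟨(√3 * v + √(3 * v ^ 2 + 4)) / 2, ?_, ?_⟩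
    all_goals
      have hw : √(3 * v ^ 2 + 4) ^ 2 = 3 * v ^ 2 + 4 := sq_sqrt (by positivity)
      have hq : 0 < √3 * v + √(3 * v ^ 2 + 4) := by
        have := sqrt_nonneg (3 * v ^ 2 + 4)
        have := (abs_lt_of_sq_lt_sq' (a := √3 * v) (by rw [hw, mul_pow, h3]; linarith) this).1
        linarith
    · exact half_pos hq
    · simp only
      generalize √(3 * v ^ 2 + 4) = w at *
      field_simp
      linear_combination hw - v ^ 2 * h3
  have hd : ∀ q ∈ Ioi (0:ℝ), HasDerivWithinAt (fun q : ℝ => (q - q⁻¹) / √3)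
      ((1 + (q ^ 2)⁻¹) / √3) (Ioi 0) q := fun q hq => by
    have := (((hasDerivAt_id q).sub (hasDerivAt_inv (ne_of_gt hq))).div_const √3)
    simpa using! this.hasDerivWithinAt
  have hinj : InjOn (fun q : ℝ => (q - q⁻¹) / √3) (Ioi 0) := by
    intro p hp q hq h
    have hp : 0 < p := hp
    have hq : 0 < q := hq
    have h : p - p⁻¹ = q - q⁻¹ := by simpa [div_left_inj' h3p.ne'] using h
    have h0 : (p - q) * (p * q + 1) = 0 := by
      field_simp at h
      linear_combination h
    rcases mul_eq_zero.1 h0 with h0 | h0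
    · linarith
    · nlinarith [mul_pos hp hq]
  have hG : ∫⁻ v : ℝ, ENNReal.ofReal (1 / √3 * (1 / (1 + v ^ 2) *
      log ((2 + √(3 * v ^ 2 + 4)) / (√3 * v) *
      ((√(3 * v ^ 2 + 4) - 1) / (√(3 * v ^ 2 + 4) + 1)))))
      = ENNReal.ofReal (2 / √3 * (π / 4 * log 3)) := by
    rw [lintegral_eq_two_mul_of_even]
    · simp_rw [ENNReal.ofReal_mul (show 0 ≤ 1 / √3 by positivity)]
      rw [lintegral_const_mul' _ _ ENNReal.ofReal_ne_top, lintegral_log_mul_log,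
        ← ENNReal.ofReal_mul (by positivity), ← ENNReal.ofReal_ofNat,
        ← ENNReal.ofReal_mul (by positivity)]
      congr 1
      ring
    · intro v
      rw [neg_sq, mul_neg, div_neg, neg_mul, log_neg_eq_log]
  symm
  rw [← hG, ← setLIntegral_univ, ← him,
    lintegral_image_eq_lintegral_abs_deriv_mul measurableSet_Ioi hd hinj]
  refine setLIntegral_congr_fun measurableSet_Ioi fun q hq => ?_
  have hq : 0 < q := hq
  have hv : √3 * ((q - q⁻¹) / √3) = q - q⁻¹ := by field_simp
  have hw : √(3 * ((q - q⁻¹) / √3) ^ 2 + 4) = q + q⁻¹ := by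
    rw [← sqrt_sq (by positivity : 0 ≤ q + q⁻¹), div_pow, h3]
    congr 1
    field_simp
    ring
  have hlog : log ((2 + (q + q⁻¹)) / (q - q⁻¹) * ((q + q⁻¹ - 1) / (q + q⁻¹ + 1)))
      = log ((1 + q ^ 3) / (1 - q ^ 3)) := by
    rcases eq_or_ne q 1 with rfl | h1
    · norm_num
    have h1 : q - 1 ≠ 0 := sub_ne_zero.2 h1
    rw [← log_neg_eq_log]
    congr 1
    have e1 : 1 - q ^ 3 = -((q - 1) * (q ^ 2 + q + 1)) := by ring
    have e2 : q - q⁻¹ = (q - 1) * (q + 1) / q := by field_simp; ring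
    have e3 : q + q⁻¹ + 1 = (q ^ 2 + q + 1) / q := by field_simp; ring
    rw [e1, e2, e3]
    field_simp
    ring
  rw [hv, hw, hlog, ← ENNReal.ofReal_mul (abs_nonneg _), abs_of_pos (by positivity), ← mul_assoc,
    ← mul_assoc, div_pow, h3]
  congr 2
  field_simp
  rw [h3]
  ring

theorem lintegral_mul_exp_neg_mul {b : ℝ} (hb : 0 < b) :
    ∫⁻ x in Ioi 0, ENNReal.ofReal (x * exp (-(b * x))) = ENNReal.ofReal (1 / b ^ 2) := by
  have hd : ∀ x, HasDerivAt (fun x => -(b * x * exp (-(b * x)) + exp (-(b * x))) / b ^ 2)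
      (x * exp (-(b * x))) x := fun x => by
    have e1 : HasDerivAt (fun x => b * x) b x := by
      simpa using (hasDerivAt_id x).const_mul b
    refine ((((e1.mul e1.neg.exp).add e1.neg.exp).neg).div_const (b ^ 2)).congr_deriv ?_
    simp only [Pi.neg_apply]
    field_simp
    ring
  have hl : Tendsto (fun x => -(b * x * exp (-(b * x)) + exp (-(b * x))) / b ^ 2) atTop
      (𝓝 (-(0 + 0) / b ^ 2)) := by
    have hbx : Tendsto (fun x => b * x) atTop atTop := tendsto_id.const_mul_atTop hb
    refine ((Tendsto.add ?_ ?_).neg).div_const _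
    · simpa [Function.comp_def] using (tendsto_pow_mul_exp_neg_atTop_nhds_zero 1).comp hbx
    · exact tendsto_exp_neg_atTop_nhds_zero.comp hbx
  rw [lintegral_Ioi_of_hasDerivAt (hd 0).continuousAt.continuousWithinAt (fun x _ => hd x)
    (fun x hx => mul_nonneg (le_of_lt hx) (exp_pos _).le) hl]
  congr 1
  simp
  field_simp

theorem tendsto_cosh_quotient_atTop {P Q : ℝ} (hP : 0 < P) (hQ : 0 < Q) (s : ℝ) :
    Tendsto (fun d => (P * sinh (d / 2) - Q * sinh ((s - d) / 2)) /
      (P * cosh (d / 2) + Q * cosh ((s - d) / 2))) atTop (𝓝 1) := by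
  have hp : 0 < P + Q * exp (-(s / 2)) := by positivity
  have h : Tendsto (fun d => (P * (1 - exp (-d)) - Q * (exp (s / 2) * exp (-d) - exp (-(s / 2)))) /
      (P * (1 + exp (-d)) + Q * (exp (s / 2) * exp (-d) + exp (-(s / 2))))) atTop
      (𝓝 ((P * (1 - 0) - Q * (exp (s / 2) * 0 - exp (-(s / 2)))) /
      (P * (1 + 0) + Q * (exp (s / 2) * 0 + exp (-(s / 2)))))) := by
    have e := tendsto_exp_neg_atTop_nhds_zero
    refine Tendsto.div ?_ ?_ ?_
    · exact ((e.const_sub 1).const_mul P).sub (((e.const_mul _).sub_const _).const_mul Q)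
    · exact ((e.const_add 1).const_mul P).add (((e.const_mul _).add_const _).const_mul Q)
    · simpa using hp.ne'
  have hlim : (P * (1 - 0) - Q * (exp (s / 2) * 0 - exp (-(s / 2)))) /
      (P * (1 + 0) + Q * (exp (s / 2) * 0 + exp (-(s / 2)))) = 1 := by
    rw [div_eq_one_iff_eq (by simpa using hp.ne')]; ring
  rw [hlim] at h
  refine h.congr fun d => ?_
  have e1 : exp (-d) = exp (-(d / 2)) / exp (d / 2) := by rw [← exp_sub]; ring_nf
  have e2 : exp ((s - d) / 2) = exp (s / 2) / exp (d / 2) := by rw [← exp_sub]; ring_nf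
  have e3 : exp (-((s - d) / 2)) = exp (-(s / 2)) * exp (d / 2) := by rw [← exp_add]; ring_nf
  rw [sinh_eq, sinh_eq, cosh_eq, cosh_eq, e1, e2, e3, exp_neg (d / 2)]
  have := exp_pos (d / 2)
  have := exp_pos (s / 2)
  have := exp_pos (-(s / 2))
  rw [div_eq_div_iff (by positivity) (by positivity)]
  field_simp

theorem lintegral_inv_sq_cosh_add_cosh {P Q : ℝ} (hP : 0 < P) (hQ : 0 < Q) (s : ℝ) :
    ∫⁻ d, ENNReal.ofReal (1 / (2 * (P * cosh (d / 2) + Q * cosh ((s - d) / 2))) ^ 2)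
      = ENNReal.ofReal (1 / (P ^ 2 + Q ^ 2 + 2 * P * Q * cosh (s / 2))) := by
  have hN : 0 < P ^ 2 + Q ^ 2 + 2 * P * Q * cosh (s / 2) := by
    have := cosh_pos (s / 2); positivity
  have hX : ∀ d, 0 < P * cosh (d / 2) + Q * cosh ((s - d) / 2) := fun d => by
    have := cosh_pos (d / 2)
    have := cosh_pos ((s - d) / 2)
    positivity
  have hd : ∀ d, HasDerivAt (fun d => (P * sinh (d / 2) - Q * sinh ((s - d) / 2)) /
      (P * cosh (d / 2) + Q * cosh ((s - d) / 2)) /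
        (2 * (P ^ 2 + Q ^ 2 + 2 * P * Q * cosh (s / 2))))
      (1 / (2 * (P * cosh (d / 2) + Q * cosh ((s - d) / 2))) ^ 2) d := fun d => by
    have a1 := (hasDerivAt_id d).div_const 2
    have a2 := ((hasDerivAt_id d).const_sub s).div_const 2
    refine ((((a1.sinh.const_mul P).sub (a2.sinh.const_mul Q)).div
      ((a1.cosh.const_mul P).add (a2.cosh.const_mul Q)) (hX d).ne').div_const _).congr_deriv ?_
    have hs : cosh (s / 2) =
        cosh (d / 2) * cosh ((s - d) / 2) + sinh (d / 2) * sinh ((s - d) / 2) := by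
      rw [← cosh_add]; ring_nf
    have := hX d
    simp only [id, Pi.add_apply, Pi.sub_apply]
    rw [hs] at hN ⊢
    have c1 := cosh_sq (d / 2)
    have c2 := cosh_sq ((s - d) / 2)
    generalize cosh (d / 2) = C at *
    generalize sinh (d / 2) = S at *
    generalize cosh ((s - d) / 2) = C' at *
    generalize sinh ((s - d) / 2) = S' at *
    generalize hNe : P ^ 2 + Q ^ 2 + 2 * P * Q * (C * C' + S * S') = N at *
    field_simp
    linear_combination P ^ 2 * c1 + Q ^ 2 * c2 + hNe
  have hbot : Tendsto (fun d => (P * sinh (d / 2) - Q * sinh ((s - d) / 2)) /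
      (P * cosh (d / 2) + Q * cosh ((s - d) / 2))) atBot (𝓝 (-1)) := by
    refine (((tendsto_cosh_quotient_atTop hP hQ (-s)).comp tendsto_neg_atBot_atTop).neg).congr
      fun d => ?_
    simp only [Function.comp_apply]
    rw [show (-s - -d) / 2 = -((s - d) / 2) by ring, neg_div, sinh_neg, sinh_neg, cosh_neg,
      cosh_neg, ← neg_div]
    ring
  rw [lintegral_of_hasDerivAt hd (fun d => by positivity) (hbot.div_const _)
    ((tendsto_cosh_quotient_atTop hP hQ s).div_const _)]
  congr 1
  field_simp
  ring

/-- The left side is `(2 K_{1/3}(x))²`. -/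
theorem sq_lintegral_exp_neg_mul_cosh (x : ℝ) :
    (∫⁻ t, ENNReal.ofReal (exp (-x * cosh t + t / 3))) ^ 2
      = ∫⁻ u, ∫⁻ d, ENNReal.ofReal (exp (-x * (2 * cosh u * cosh (d / 2)) + d / 3)) := by
  have hneg : ∫⁻ t, ENNReal.ofReal (exp (-x * cosh t + t / 3))
      = ∫⁻ t, ENNReal.ofReal (exp (-x * cosh t - t / 3)) := by
    rw [← lintegral_neg_eq_self]
    refine lintegral_congr fun t => ?_
    rw [cosh_neg, neg_div, ← sub_eq_add_neg]
  have hshift : ∀ t, ∫⁻ d, ENNReal.ofReal (exp (-x * cosh d + d / 3)) *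
      ENNReal.ofReal (exp (-x * cosh t - t / 3))
      = ∫⁻ d, ENNReal.ofReal (exp (-x * (cosh (d + t) + cosh t) + d / 3)) := fun t => by
    rw [← lintegral_add_right_eq_self _ t]
    refine lintegral_congr fun d => ?_
    rw [← ENNReal.ofReal_mul (exp_pos _).le, ← exp_add]
    ring_nf
  rw [sq]
  nth_rw 2 [hneg]
  rw [← lintegral_const_mul _ (by fun_prop)]
  simp_rw [← lintegral_mul_const _ (show Measurable fun t => ENNReal.ofReal
    (exp (-x * cosh t + t / 3)) by fun_prop), hshift]
  refine (lintegral_lintegral_swap (by fun_prop)).trans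
    (Eq.trans ?_ (lintegral_lintegral_swap (by fun_prop)).symm)
  refine lintegral_congr fun d => ?_
  rw [← lintegral_sub_right_eq_self _ (d / 2)]
  refine lintegral_congr fun u => ?_
  have h : cosh (d + (u - d / 2)) + cosh (u - d / 2) = 2 * cosh u * cosh (d / 2) := by
    rw [show d + (u - d / 2) = u + d / 2 by ring, cosh_add, cosh_sub]
    ring
  rw [h]

theorem lintegral_mul_lintegral_mul_lintegral {P Q : ℝ} (hP : 0 < P) (hQ : 0 < Q) :
    ∫⁻ x in Ioi 0, ENNReal.ofReal x *
      ((∫⁻ d, ENNReal.ofReal (exp (-x * (2 * P * cosh (d / 2)) + d / 3))) *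
        ∫⁻ d, ENNReal.ofReal (exp (-x * (2 * Q * cosh (d / 2)) + d / 3)))
      = ∫⁻ s, ENNReal.ofReal (exp (s / 3) / (P ^ 2 + Q ^ 2 + 2 * P * Q * cosh (s / 2))) := by
  have hX : ∀ d s, 0 < P * cosh (d / 2) + Q * cosh ((s - d) / 2) := fun d s => by
    have := cosh_pos (d / 2)
    have := cosh_pos ((s - d) / 2)
    positivity
  have h1 : ∀ x : ℝ, ENNReal.ofReal x *
      ((∫⁻ d, ENNReal.ofReal (exp (-x * (2 * P * cosh (d / 2)) + d / 3))) *
        ∫⁻ d, ENNReal.ofReal (exp (-x * (2 * Q * cosh (d / 2)) + d / 3)))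
      = ∫⁻ s, ∫⁻ d, ENNReal.ofReal (exp (s / 3)) * ENNReal.ofReal
        (x * exp (-(2 * (P * cosh (d / 2) + Q * cosh ((s - d) / 2)) * x))) := fun x => by
    rw [← lintegral_mul_const _ (by fun_prop), ← lintegral_const_mul _ (by fun_prop)]
    refine Eq.trans (lintegral_congr fun d => ?_) (lintegral_lintegral_swap (by fun_prop))
    rw [← lintegral_const_mul _ (by fun_prop), ← lintegral_const_mul _ (by fun_prop),
      ← lintegral_sub_right_eq_self _ d]
    refine lintegral_congr fun s => ?_
    rw [← ENNReal.ofReal_mul (exp_pos _).le, ← ENNReal.ofReal_mul' (by positivity),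
      ← ENNReal.ofReal_mul (exp_pos _).le, ← exp_add,
      mul_left_comm (exp _) x, ← exp_add]
    ring_nf
  simp_rw [h1]
  rw [lintegral_lintegral_swap (by fun_prop)]
  refine lintegral_congr fun s => ?_
  rw [lintegral_lintegral_swap (by fun_prop)]
  simp_rw [lintegral_const_mul' _ _ ENNReal.ofReal_ne_top]
  rw [lintegral_congr fun d => lintegral_mul_exp_neg_mul (mul_pos two_pos (hX d s)),
    lintegral_inv_sq_cosh_add_cosh hP hQ, ← ENNReal.ofReal_mul (exp_pos _).le, mul_one_div]

theorem lintegral_mul_pow_four :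
    ∫⁻ x in Ioi 0, ENNReal.ofReal x * (∫⁻ t, ENNReal.ofReal (exp (-x * cosh t + t / 3))) ^ 4
      = ENNReal.ofReal (4 * π ^ 2 * log 3) := by
  have hm : Measurable fun p : ℝ × ℝ =>
      ∫⁻ d, ENNReal.ofReal (exp (-p.1 * (2 * cosh p.2 * cosh (d / 2)) + d / 3)) := by
    refine Measurable.lintegral_prod_right' (f := fun q : (ℝ × ℝ) × ℝ =>
      ENNReal.ofReal (exp (-q.1.1 * (2 * cosh q.1.2 * cosh (q.2 / 2)) + q.2 / 3))) ?_
    fun_prop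
  have h1 : ∀ x : ℝ, ENNReal.ofReal x *
      (∫⁻ t, ENNReal.ofReal (exp (-x * cosh t + t / 3))) ^ 4
      = ∫⁻ v, ∫⁻ u, ENNReal.ofReal x *
      ((∫⁻ d, ENNReal.ofReal (exp (-x * (2 * cosh u * cosh (d / 2)) + d / 3))) *
        ∫⁻ d, ENNReal.ofReal (exp (-x * (2 * cosh v * cosh (d / 2)) + d / 3))) := fun x => by
    have hx : Measurable fun u : ℝ =>
        ∫⁻ d, ENNReal.ofReal (exp (-x * (2 * cosh u * cosh (d / 2)) + d / 3)) :=
      hm.comp (measurable_const.prodMk measurable_id)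
    rw [pow_mul _ 2 2, sq_lintegral_exp_neg_mul_cosh, sq, ← lintegral_const_mul _ hx,
      ← lintegral_const_mul _ (hx.const_mul _)]
    refine lintegral_congr fun v => ?_
    rw [← lintegral_mul_const _ hx, ← lintegral_const_mul _ (hx.mul_const _)]
  set H : ℝ → ℝ≥0∞ := fun r =>
    ∫⁻ s, ENNReal.ofReal (exp (s / 3) / (r + r⁻¹ + 2 * cosh (s / 2))) with hH
  have hHm : Measurable H := by
    refine Measurable.lintegral_prod_right' (f := fun q : ℝ × ℝ =>
      ENNReal.ofReal (exp (q.2 / 3) / (q.1 + q.1⁻¹ + 2 * cosh (q.2 / 2)))) ?_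
    fun_prop
  have h2 : ∀ u v : ℝ, ∫⁻ s, ENNReal.ofReal
      (exp (s / 3) / (cosh u ^ 2 + cosh v ^ 2 + 2 * cosh u * cosh v * cosh (s / 2)))
      = ENNReal.ofReal (1 / cosh v) * (ENNReal.ofReal (1 / cosh u) * H (cosh u / cosh v)) :=
    fun u v => by
    have hu := cosh_pos u
    have hv := cosh_pos v
    rw [hH, ← lintegral_const_mul' _ _ ENNReal.ofReal_ne_top,
      ← lintegral_const_mul' _ _ ENNReal.ofReal_ne_top]
    refine lintegral_congr fun s => ?_
    have hs := cosh_pos (s / 2)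
    rw [← ENNReal.ofReal_mul (by positivity), ← ENNReal.ofReal_mul (by positivity)]
    congr 1
    field_simp
  have him : (fun q : ℝ => q ^ 3) '' Ioi 0 = Ioi 0 := by
    ext r
    refine ⟨fun ⟨q, hq, h⟩ => h ▸ pow_pos (mem_Ioi.1 hq) 3,
      fun hr => ⟨r ^ (3⁻¹ : ℝ), rpow_pos_of_pos hr _, ?_⟩⟩
    exact rpow_inv_natCast_pow (le_of_lt hr) three_ne_zero
  have hinj : InjOn (fun q : ℝ => q ^ 3) (Ioi 0) := fun p hp q hq h =>
    (pow_left_inj₀ (le_of_lt hp) (le_of_lt hq) three_ne_zero).1 h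
  simp_rw [h1]
  have hm2 : Measurable fun p : ℝ × ℝ × ℝ => ENNReal.ofReal p.1 *
      ((∫⁻ d, ENNReal.ofReal (exp (-p.1 * (2 * cosh p.2.1 * cosh (d / 2)) + d / 3))) *
        ∫⁻ d, ENNReal.ofReal (exp (-p.1 * (2 * cosh p.2.2 * cosh (d / 2)) + d / 3))) :=
    measurable_fst.ennreal_ofReal.mul
      ((hm.comp (measurable_fst.prodMk measurable_snd.fst)).mul
        (hm.comp (measurable_fst.prodMk measurable_snd.snd)))
  rw [lintegral_lintegral_swap (Measurable.lintegral_prod_right' (f := fun q : (ℝ × ℝ) × ℝ => _)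
    (hm2.comp (measurable_fst.fst.prodMk
      (measurable_snd.prodMk measurable_fst.snd)))).aemeasurable]
  have h3 : ∀ v : ℝ, ∫⁻ x in Ioi 0, ∫⁻ u, ENNReal.ofReal x *
      ((∫⁻ d, ENNReal.ofReal (exp (-x * (2 * cosh u * cosh (d / 2)) + d / 3))) *
        ∫⁻ d, ENNReal.ofReal (exp (-x * (2 * cosh v * cosh (d / 2)) + d / 3)))
      = ∫⁻ u, ENNReal.ofReal (1 / cosh v) *
        (ENNReal.ofReal (1 / cosh u) * H (cosh u / cosh v)) := fun v => by
    rw [lintegral_lintegral_swap]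
    swap
    · exact (hm2.comp (measurable_fst.prodMk
        (measurable_snd.prodMk measurable_const))).aemeasurable
    refine lintegral_congr fun u => ?_
    rw [lintegral_mul_lintegral_mul_lintegral (cosh_pos u) (cosh_pos v), h2]
  simp_rw [h3]
  rw [lintegral_lintegral_cosh_ratio hHm]
  nth_rw 1 [← him]
  rw [lintegral_image_eq_lintegral_abs_deriv_mul measurableSet_Ioi
    (fun q _ => (hasDerivAt_pow 3 q).hasDerivWithinAt) hinj]
  have h4 : ∀ᵐ q ∂volume.restrict (Ioi (0:ℝ)),
      ENNReal.ofReal |((3:ℕ):ℝ) * q ^ (3 - 1)| *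
        (ENNReal.ofReal (1 / 2 * log ((1 + q ^ 3) / (1 - q ^ 3))) *
          (ENNReal.ofReal (1 / q ^ 3) * H (q ^ 3)))
      = ENNReal.ofReal (6 * π / √3) * ENNReal.ofReal
        ((q ^ 2 + 1) / (q ^ 4 + q ^ 2 + 1) * log ((1 + q ^ 3) / (1 - q ^ 3))) := by
    filter_upwards [self_mem_ae_restrict measurableSet_Ioi,
      ae_restrict_of_ae (Measure.ae_ne volume (1:ℝ))] with q hq hq1
    have hq : 0 < q := hq
    have hc : 0 ≤ 4 * π / √3 * (q * (q ^ 2 + 1) / (q ^ 4 + q ^ 2 + 1)) := by positivity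
    simp only [hH]
    rw [lintegral_exp_div_cosh hq hq1, ← ENNReal.ofReal_mul (by positivity),
      ← ENNReal.ofReal_mul' (by positivity), ← ENNReal.ofReal_mul (by positivity),
      ← ENNReal.ofReal_mul (by positivity), abs_of_pos (by positivity)]
    congr 1
    field_simp
    push_cast
    ring
  rw [lintegral_congr_ae h4, lintegral_const_mul' _ _ ENNReal.ofReal_ne_top,
    lintegral_div_quartic_mul_log, ← ENNReal.ofReal_mul (by positivity), ← ENNReal.ofReal_ofNat,
    ← ENNReal.ofReal_mul (by positivity)]
  congr 1
  have hs : √3 ^ 2 = 3 := sq_sqrt (by norm_num)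
  field_simp
  rw [hs]
  ring

theorem besselK_one_third (x : ℝ) : besselK (1 / 3) x =
    ((∫⁻ t, ENNReal.ofReal (exp (-x * cosh t + t / 3))) / 2).toReal := by
  rw [besselK, integral_eq_lintegral_of_nonneg_ae
    (ae_of_all _ fun t => mul_nonneg (exp_pos _).le (cosh_pos _).le) (by fun_prop),
    lintegral_eq_add_lintegral_Ioi, ← lintegral_add_left (by fun_prop), ENNReal.div_eq_inv_mul,
    ← lintegral_const_mul _ (by fun_prop)]
  congr 1
  refine lintegral_congr fun t => ?_
  rw [← ENNReal.ofReal_add (by positivity) (by positivity), ← ENNReal.ofReal_ofNat,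
    ← ENNReal.ofReal_inv_of_pos two_pos, ← ENNReal.ofReal_mul (by positivity)]
  congr 1
  rw [cosh_neg, exp_add, exp_add, cosh_eq (1 / 3 * t)]
  ring_nf

theorem integral_mul_besselK_one_third_pow_four :
    ∫ x in Ioi 0, x * besselK (1 / 3) x ^ 4 = π ^ 2 / 4 * log 3 := by
  have hm : Measurable fun x : ℝ => ∫⁻ t, ENNReal.ofReal (exp (-x * cosh t + t / 3)) := by
    refine Measurable.lintegral_prod_right' (f := fun q : ℝ × ℝ =>
      ENNReal.ofReal (exp (-q.1 * cosh q.2 + q.2 / 3))) ?_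
    fun_prop
  have hfin : ∀ᵐ x ∂volume.restrict (Ioi (0:ℝ)), ENNReal.ofReal x *
      (∫⁻ t, ENNReal.ofReal (exp (-x * cosh t + t / 3))) ^ 4 < ∞ :=
    ae_lt_top (measurable_id.ennreal_ofReal.mul (hm.pow_const 4))
      (by rw [lintegral_mul_pow_four]; exact ENNReal.ofReal_ne_top)
  have hval : ∫⁻ x in Ioi 0, ENNReal.ofReal (x * besselK (1 / 3) x ^ 4)
      = ENNReal.ofReal (1 / 16) * ENNReal.ofReal (4 * π ^ 2 * log 3) := by
    rw [← lintegral_mul_pow_four, ← lintegral_const_mul' _ _ ENNReal.ofReal_ne_top]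
    refine lintegral_congr_ae ?_
    filter_upwards [hfin, self_mem_ae_restrict measurableSet_Ioi] with x hx h0
    have h0 : 0 < x := h0
    simp only [besselK_one_third]
    generalize ∫⁻ t, ENNReal.ofReal (exp (-x * cosh t + t / 3)) = k at *
    have hk : k ≠ ∞ := by
      rintro rfl
      simp [ENNReal.mul_top, h0] at hx
    lift k to NNReal using hk
    have : ((k : ℝ≥0∞)) = ENNReal.ofReal k := (ENNReal.ofReal_coe_nnreal).symm
    rw [this, ENNReal.toReal_div, ENNReal.toReal_ofReal k.coe_nonneg,
      ← ENNReal.ofReal_pow k.coe_nonneg, ← ENNReal.ofReal_mul h0.le,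
      ← ENNReal.ofReal_mul (by norm_num), ENNReal.toReal_ofNat]
    congr 1
    ring
  rw [integral_eq_lintegral_of_nonneg_ae, hval, ← ENNReal.ofReal_mul (by norm_num),
    ENNReal.toReal_ofReal]
  · ring
  · have := log_pos (by norm_num : (1:ℝ) < 3)
    positivity
  · filter_upwards [self_mem_ae_restrict measurableSet_Ioi] with x hx
    exact mul_nonneg (le_of_lt hx) (by positivity)
  · simp only [besselK_one_third]
    exact (measurable_id.mul ((hm.div_const 2).ennreal_toReal.pow_const 4)).aestronglyMeasurable

end

theorem stmt8 (a : ℝ) (ha : 0 < a) :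
    (∫ x in Set.Ioi (0:ℝ), x * (besselK (1 / 3) (a * x)) ^ 4)
    = (π ^ 2 / (4 * a ^ 2)) * Real.log 3 := by
  have h := integral_comp_mul_left_Ioi (fun x => x * besselK (1 / 3) x ^ 4) 0 ha
  simp_rw [mul_zero, integral_mul_besselK_one_third_pow_four, mul_assoc a, integral_const_mul,
    smul_eq_mul] at h
  rw [eq_div_of_mul_eq ha.ne' ((mul_comm _ _).trans h)]
  field_simp
end

section
/- Let a > 0 be real. Then ∫₀^∞ x K_{1/4}⁴(a x) dx = (π²/(4a²)) ln 2. -/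
open MeasureTheory Real

open scoped ENNReal Topology
open Filter

/-- The fundamental theorem of calculus on the real line for a nonnegative derivative. -/
theorem lintegral_of_hasDerivAt_of_nonneg {F f : ℝ → ℝ} {m n : ℝ}
    (hF : ∀ x, HasDerivAt F (f x) x) (hf : Continuous f) (hf0 : ∀ x, 0 ≤ f x)
    (hbot : Tendsto F atBot (𝓝 m)) (htop : Tendsto F atTop (𝓝 n)) :
    ∫⁻ x, ENNReal.ofReal (f x) = ENNReal.ofReal (n - m) := by
  have hmono : Monotone F := monotone_of_deriv_nonneg (fun x ↦ (hF x).differentiableAt)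
    fun x ↦ (hF x).deriv ▸ hf0 x
  have hint : Integrable f := by
    refine integrable_of_intervalIntegral_norm_bounded (l := atTop) (a := fun i : ℝ ↦ -i)
      (b := fun i ↦ i) (n - m) (fun i ↦ hf.integrableOn_Ioc) tendsto_neg_atTop_atBot tendsto_id
      (Eventually.of_forall fun i ↦ ?_)
    simp only [norm_of_nonneg (hf0 _)]
    rw [intervalIntegral.integral_eq_sub_of_hasDerivAt (fun x _ ↦ hF x)
      (hf.intervalIntegrable _ _)]
    exact sub_le_sub (hmono.ge_of_tendsto htop i) (hmono.le_of_tendsto hbot (-i))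
  rw [← ofReal_integral_eq_lintegral_ofReal hint (ae_of_all _ hf0),
    integral_of_hasDerivAt_of_tendsto hF hint hbot htop]

theorem lintegral_comp_of_bijective {φ φ' : ℝ → ℝ} (hφ : ∀ x, HasDerivAt φ (φ' x) x)
    (hφ' : ∀ x, 0 ≤ φ' x) (hb : φ.Bijective) (g : ℝ → ℝ≥0∞) :
    ∫⁻ x, ENNReal.ofReal (φ' x) * g (φ x) = ∫⁻ x, g x := by
  have h := lintegral_image_eq_lintegral_abs_deriv_mul MeasurableSet.univ
    (fun x _ ↦ (hφ x).hasDerivWithinAt) hb.injective.injOn g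
  simp only [Set.image_univ, hb.surjective.range_eq, Measure.restrict_univ, abs_of_nonneg (hφ' _)]
    at h
  exact h.symm

theorem lintegral_lintegral_add_sub {F : ℝ → ℝ → ℝ≥0∞} (hF : Measurable F.uncurry) :
    ∫⁻ t, ∫⁻ s, F t s = 2 * ∫⁻ b, ∫⁻ a, F (a + b) (a - b) := by
  have h1 (t : ℝ) : ∫⁻ s, F t s = 2 * ∫⁻ b, F t (t - 2 * b) := by
    rw [← lintegral_sub_left_eq_self (fun s ↦ F t s) t,
      ← lintegral_comp_of_bijective (φ := fun b ↦ 2 * b) (φ' := fun _ ↦ 2)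
        (fun x ↦ by simpa using (hasDerivAt_id x).const_mul (2 : ℝ)) (fun _ ↦ by norm_num)
        (mulLeft_bijective₀ 2 two_ne_zero), lintegral_const_mul' _ _ (by simp)]
    simp
  have hm : Measurable (fun p : ℝ × ℝ ↦ F p.1 (p.1 - 2 * p.2)) :=
    hF.comp (by fun_prop : Measurable fun p : ℝ × ℝ ↦ (p.1, p.1 - 2 * p.2))
  simp_rw [h1]
  rw [lintegral_const_mul' _ _ (by simp), lintegral_lintegral_swap hm.aemeasurable]
  congr 1
  refine lintegral_congr fun b ↦ ?_
  rw [← lintegral_add_right_eq_self _ b]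
  refine lintegral_congr fun a ↦ ?_
  congr 1; ring

theorem lintegral_exp_neg_mul_cosh_mul_cosh_half {z : ℝ} (hz : 0 < z) :
    ∫⁻ t, ENNReal.ofReal (exp (-z * cosh t) * cosh (t / 2))
      = ENNReal.ofReal (√(2 * π / z) * exp (-z)) := by
  have hb : Function.Bijective (fun t : ℝ ↦ sinh (t / 2)) :=
    sinh_bijective.comp (mulRight_bijective₀ (2⁻¹ : ℝ) (by norm_num))
  have hd (t : ℝ) : HasDerivAt (fun t : ℝ ↦ sinh (t / 2)) (cosh (t / 2) / 2) t := by
    have := ((hasDerivAt_id t).div_const 2).sinh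
    simpa [div_eq_mul_inv] using this
  have h := lintegral_comp_of_bijective hd (fun t ↦ by positivity) hb
    (fun v ↦ ENNReal.ofReal (2 * exp (-z) * exp (-(2 * z) * v ^ 2)))
  have h2 (t : ℝ) : ENNReal.ofReal (exp (-z * cosh t) * cosh (t / 2)) =
      ENNReal.ofReal (cosh (t / 2) / 2) *
        ENNReal.ofReal (2 * exp (-z) * exp (-(2 * z) * sinh (t / 2) ^ 2)) := by
    rw [← ENNReal.ofReal_mul (by positivity), mul_assoc 2, ← exp_add]
    have : cosh t = 1 + 2 * sinh (t / 2) ^ 2 := by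
      have := cosh_two_mul (t / 2)
      rw [cosh_sq, mul_div_cancel₀ t two_ne_zero] at this
      linarith
    rw [this]; congr 1; ring_nf
  simp_rw [h2]
  rw [h, ← ofReal_integral_eq_lintegral_ofReal
    ((integrable_exp_neg_mul_sq (by positivity)).const_mul _) (ae_of_all _ fun x ↦ by positivity),
    integral_const_mul, integral_gaussian]
  congr 1
  have : 2 * π / z = 2 ^ 2 * (π / (2 * z)) := by field_simp
  rw [this, sqrt_mul (by norm_num), sqrt_sq (by norm_num)]
  ring

/-- Up to the factor `2`, the integral defining `besselK (1 / 4) x`, over the whole real line. -/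
noncomputable def lintegralExpCosh (x : ℝ) : ℝ≥0∞ :=
  ∫⁻ t, ENNReal.ofReal (exp (-x * cosh t) * cosh (t / 4))

theorem measurable_lintegralExpCosh : Measurable lintegralExpCosh :=
  Measurable.lintegral_prod_right' (f := fun p : ℝ × ℝ ↦
    ENNReal.ofReal (exp (-p.1 * cosh p.2) * cosh (p.2 / 4))) (by fun_prop)

theorem besselK_one_div_four (x : ℝ) :
    besselK (1 / 4) x = (lintegralExpCosh x).toReal / 2 := by
  have h := integral_comp_abs (f := fun t ↦ exp (-x * cosh t) * cosh (t / 4))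
  rw [besselK, lintegralExpCosh, ← integral_eq_lintegral_of_nonneg_ae
    (ae_of_all _ fun t ↦ by positivity) (by fun_prop)]
  have h3 : ∀ t : ℝ, cosh (|t| / 4) = cosh (t / 4) := fun t ↦ by
    rw [← cosh_abs (t / 4), abs_div, abs_of_pos (by norm_num : (0 : ℝ) < 4)]
  simp only [cosh_abs, h3] at h
  rw [h]
  simp only [one_div_mul_eq_div]
  ring

theorem lintegralExpCosh_sq {x : ℝ} (hx : 0 < x) :
    lintegralExpCosh x ^ 2
      = 2 * ∫⁻ b, ENNReal.ofReal (√(π / (x * cosh b)) * exp (-(2 * x * cosh b))) := by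
  have key (a b : ℝ) :
      ENNReal.ofReal (exp (-x * cosh (a + b)) * cosh ((a + b) / 4)) *
        ENNReal.ofReal (exp (-x * cosh (a - b)) * cosh ((a - b) / 4)) =
      ENNReal.ofReal (1 / 2) * (ENNReal.ofReal (exp (-(2 * x * cosh b) * cosh a) * cosh (a / 2)) +
        ENNReal.ofReal (exp (-(2 * x * cosh a) * cosh b) * cosh (b / 2))) := by
    rw [← ENNReal.ofReal_mul (by positivity), ← ENNReal.ofReal_add (by positivity) (by positivity),
      ← ENNReal.ofReal_mul (by positivity)]
    congr 1
    have h1 : cosh ((a + b) / 4) * cosh ((a - b) / 4) = (cosh (a / 2) + cosh (b / 2)) / 2 := by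
      rw [show a / 2 = (a + b) / 4 + (a - b) / 4 by ring,
        show b / 2 = (a + b) / 4 - (a - b) / 4 by ring, cosh_add, cosh_sub]
      ring
    rw [mul_mul_mul_comm, ← exp_add, h1, cosh_add, cosh_sub]
    ring_nf
  have hm : Measurable fun p : ℝ × ℝ ↦
      ENNReal.ofReal (exp (-(2 * x * cosh p.1) * cosh p.2) * cosh (p.2 / 2)) := by fun_prop
  have hm' : Measurable fun p : ℝ × ℝ ↦
      ENNReal.ofReal (exp (-(2 * x * cosh p.2) * cosh p.1) * cosh (p.1 / 2)) := by fun_prop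
  rw [sq, lintegralExpCosh, ← lintegral_lintegral_mul (by fun_prop) (by fun_prop),
    lintegral_lintegral_add_sub (F := fun t s ↦ ENNReal.ofReal (exp (-x * cosh t) * cosh (t / 4)) *
      ENNReal.ofReal (exp (-x * cosh s) * cosh (s / 4))) (by unfold Function.uncurry; fun_prop)]
  simp_rw [key]
  have h2 : ∀ b : ℝ, ∫⁻ a, ENNReal.ofReal (1 / 2) *
      (ENNReal.ofReal (exp (-(2 * x * cosh b) * cosh a) * cosh (a / 2)) +
        ENNReal.ofReal (exp (-(2 * x * cosh a) * cosh b) * cosh (b / 2))) =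
      ENNReal.ofReal (1 / 2) *
        ((∫⁻ a, ENNReal.ofReal (exp (-(2 * x * cosh b) * cosh a) * cosh (a / 2))) +
         ∫⁻ a, ENNReal.ofReal (exp (-(2 * x * cosh a) * cosh b) * cosh (b / 2))) := fun b ↦ by
    rw [lintegral_const_mul' _ _ (by simp), lintegral_add_left (by fun_prop)]
  simp_rw [h2]
  rw [lintegral_const_mul' _ _ (by simp), lintegral_add_left hm.lintegral_prod_right',
    lintegral_lintegral_swap (f := fun b a ↦
      ENNReal.ofReal (exp (-(2 * x * cosh a) * cosh b) * cosh (b / 2))) hm'.aemeasurable,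
    ← two_mul, ← mul_assoc (ENNReal.ofReal _)]
  have h4 : ENNReal.ofReal (1 / 2) * 2 = 1 := by
    rw [← ENNReal.ofReal_ofNat, ← ENNReal.ofReal_mul (by norm_num)]; norm_num
  rw [h4, one_mul]
  congr 1
  refine lintegral_congr fun b ↦ ?_
  dsimp only
  rw [lintegral_exp_neg_mul_cosh_mul_cosh_half (by positivity)]
  congr 3
  field_simp

theorem lintegral_exp_neg_mul_Ioi {c : ℝ} (hc : 0 < c) :
    ∫⁻ x in Set.Ioi (0 : ℝ), ENNReal.ofReal (exp (-c * x)) = ENNReal.ofReal (1 / c) := by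
  rw [← ofReal_integral_eq_lintegral_ofReal (integrableOn_exp_mul_Ioi (by linarith) 0)
    (ae_of_all _ fun x ↦ by positivity), integral_exp_mul_Ioi (by linarith)]
  simp

theorem tendsto_div_sqrt_add_sq_atTop {c : ℝ} (hc : 0 < c) :
    Tendsto (fun v ↦ v / √(c + v ^ 2)) atTop (𝓝 1) := by
  have h := (continuous_sin.tendsto (π / 2)).comp
    ((tendsto_nhds_of_tendsto_nhdsWithin tendsto_arctan_atTop).comp
      (tendsto_id.atTop_div_const (sqrt_pos.2 hc)))
  rw [sin_pi_div_two] at h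
  refine h.congr fun v ↦ ?_
  simp only [Function.comp, sin_arctan, id]
  have : 1 + (v / √c) ^ 2 = (c + v ^ 2) / c := by
    rw [div_pow, sq_sqrt hc.le]; field_simp
  rw [this, sqrt_div (by positivity)]
  have := sqrt_pos.2 hc
  field_simp

theorem tendsto_div_sqrt_add_sq_atBot {c : ℝ} (hc : 0 < c) :
    Tendsto (fun v ↦ v / √(c + v ^ 2)) atBot (𝓝 (-1)) := by
  refine ((tendsto_div_sqrt_add_sq_atTop hc).comp tendsto_neg_atBot_atTop).neg.congr fun v ↦ ?_
  simp [neg_div]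

theorem lintegral_inv_mul_sqrt {s : ℝ} (hs : s ≠ 0) :
    ∫⁻ v, ENNReal.ofReal (1 / ((1 + v ^ 2) * √(1 + s ^ 2 + v ^ 2)))
      = ENNReal.ofReal (2 * (arctan s / s)) := by
  have hc : 0 < 1 + s ^ 2 := by positivity
  have hlim {l : Filter ℝ} {e : ℝ} (h : Tendsto (fun v ↦ v / √(1 + s ^ 2 + v ^ 2)) l (𝓝 e)) :
      Tendsto (fun v ↦ arctan (s * (v / √(1 + s ^ 2 + v ^ 2))) / s) l (𝓝 (arctan (s * e) / s)) :=
    ((continuous_arctan.tendsto _).comp (h.const_mul s)).div_const s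
  have hd (v : ℝ) : HasDerivAt (fun v ↦ arctan (s * (v / √(1 + s ^ 2 + v ^ 2))) / s)
      (1 / ((1 + v ^ 2) * √(1 + s ^ 2 + v ^ 2))) v := by
    have hD : 0 < 1 + s ^ 2 + v ^ 2 := by positivity
    have h1 : HasDerivAt (fun v : ℝ ↦ 1 + s ^ 2 + v ^ 2) (2 * v) v := by
      simpa using ((hasDerivAt_id v).pow 2).const_add (1 + s ^ 2)
    have h2 := (((hasDerivAt_id v).div (h1.sqrt hD.ne')
      (sqrt_pos.2 hD).ne').const_mul s).arctan.div_const s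
    refine h2.congr_deriv ?_
    have hr := sq_sqrt hD.le
    have hr0 := sqrt_pos.2 hD
    simp only [id, Pi.div_apply]
    generalize √(1 + s ^ 2 + v ^ 2) = r at *
    have e : (1 + (s * (v / r)) ^ 2) = (1 + s ^ 2) * (1 + v ^ 2) / r ^ 2 := by
      field_simp; rw [hr]; ring
    rw [e]
    field_simp
    rw [hr]; ring
  have hcont : Continuous fun v : ℝ ↦ 1 / ((1 + v ^ 2) * √(1 + s ^ 2 + v ^ 2)) :=
    continuous_const.div (by fun_prop) fun v ↦ by positivity
  rw [lintegral_of_hasDerivAt_of_nonneg hd hcont (fun v ↦ by positivity)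
    (hlim (tendsto_div_sqrt_add_sq_atBot hc)) (hlim (tendsto_div_sqrt_add_sq_atTop hc))]
  congr 1
  simp only [mul_neg, mul_one, arctan_neg]
  ring

theorem lintegral_inv_mul_inv {w : ℝ} (hw : w ∈ Set.Ioo (0 : ℝ) 1) :
    ∫⁻ s, ENNReal.ofReal (1 / ((1 + s ^ 2) * (1 + s ^ 2 * w ^ 2)))
      = ENNReal.ofReal (π / (1 + w)) := by
  obtain ⟨h0, h1⟩ := hw
  have hw2 : 1 - w ^ 2 ≠ 0 := by nlinarith
  have ht := tendsto_nhds_of_tendsto_nhdsWithin tendsto_arctan_atTop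
  have hb := tendsto_nhds_of_tendsto_nhdsWithin tendsto_arctan_atBot
  have hd (s : ℝ) : HasDerivAt (fun s ↦ (arctan s - w * arctan (s * w)) / (1 - w ^ 2))
      (1 / ((1 + s ^ 2) * (1 + s ^ 2 * w ^ 2))) s := by
    have h2 := ((hasDerivAt_arctan s).sub
      (((hasDerivAt_id s).mul_const w).arctan.const_mul w)).div_const (1 - w ^ 2)
    refine h2.congr_deriv ?_
    simp only [id]
    have : (1 + (s * w) ^ 2) ≠ 0 := by positivity
    field_simp
    ring
  have hcont : Continuous fun s : ℝ ↦ 1 / ((1 + s ^ 2) * (1 + s ^ 2 * w ^ 2)) :=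
    continuous_const.div (by fun_prop) fun s ↦ by positivity
  rw [lintegral_of_hasDerivAt_of_nonneg hd hcont
    (fun v ↦ by positivity)
    ((hb.sub ((hb.comp (tendsto_id.atBot_mul_const h0)).const_mul w)).div_const _)
    ((ht.sub ((ht.comp (tendsto_id.atTop_mul_const h0)).const_mul w)).div_const _)]
  congr 1
  field_simp
  ring

theorem lintegral_Ioo_inv_one_add_sq_mul_sq {s : ℝ} (hs : s ≠ 0) :
    ∫⁻ w in Set.Ioo (0 : ℝ) 1, ENNReal.ofReal (1 / (1 + s ^ 2 * w ^ 2))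
      = ENNReal.ofReal (arctan s / s) := by
  have hc : Continuous fun w : ℝ ↦ 1 / (1 + s ^ 2 * w ^ 2) :=
    continuous_const.div (by fun_prop) fun v ↦ by positivity
  rw [restrict_Ioo_eq_restrict_Ioc,
    ← ofReal_integral_eq_lintegral_ofReal hc.integrableOn_Ioc (ae_of_all _ fun x ↦ by positivity),
    ← intervalIntegral.integral_of_le zero_le_one,
    intervalIntegral.integral_eq_sub_of_hasDerivAt (f := fun w ↦ arctan (s * w) / s)
      (fun w _ ↦ ?_) (hc.intervalIntegrable _ _)]
  · simp
  · refine (((hasDerivAt_id w).const_mul s).arctan.div_const s).congr_deriv ?_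
    simp only [id]
    have : (1 + (s * w) ^ 2) ≠ 0 := by positivity
    field_simp

theorem lintegral_Ioo_inv_one_add :
    ∫⁻ w in Set.Ioo (0 : ℝ) 1, ENNReal.ofReal (π / (1 + w)) = ENNReal.ofReal (π * log 2) := by
  have hc : ContinuousOn (fun w : ℝ ↦ π / (1 + w)) (Set.Icc 0 1) :=
    continuousOn_const.div (by fun_prop) fun w hw ↦ by linarith [hw.1]
  rw [restrict_Ioo_eq_restrict_Ioc, ← ofReal_integral_eq_lintegral_ofReal
      (hc.integrableOn_Icc.mono_set Set.Ioc_subset_Icc_self)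
      ((ae_restrict_iff' measurableSet_Ioc).2 (ae_of_all _ fun x hx ↦ ?_)),
    ← intervalIntegral.integral_of_le zero_le_one,
    intervalIntegral.integral_eq_sub_of_hasDerivAt (f := fun w ↦ π * log (1 + w))
      (fun w hw ↦ ?_) (ContinuousOn.intervalIntegrable (by rwa [Set.uIcc_of_le zero_le_one]))]
  · norm_num
  · rw [Set.uIcc_of_le zero_le_one] at hw
    have h1 : (1 + w) ≠ 0 := by linarith [hw.1]
    refine ((((hasDerivAt_id w).const_add 1).log h1).const_mul π).congr_deriv ?_
    simp [div_eq_mul_inv]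
  · have := hx.1
    simp only [Pi.zero_apply]; positivity

theorem lintegral_lintegral_inv_mul_sqrt :
    ∫⁻ s, ∫⁻ v, ENNReal.ofReal (1 / ((1 + s ^ 2) * ((1 + v ^ 2) * √(1 + s ^ 2 + v ^ 2))))
      = ENNReal.ofReal (2 * π * log 2) := by
  have h1 : ∀ᵐ s : ℝ, ∫⁻ v, ENNReal.ofReal (1 / ((1 + s ^ 2) * ((1 + v ^ 2) *
      √(1 + s ^ 2 + v ^ 2)))) = 2 * ∫⁻ w in Set.Ioo (0 : ℝ) 1,
        ENNReal.ofReal (1 / ((1 + s ^ 2) * (1 + s ^ 2 * w ^ 2))) := by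
    filter_upwards [compl_mem_ae_iff.2 (measure_singleton (0 : ℝ))] with s hs
    simp_rw [← one_div_mul_one_div (1 + s ^ 2),
      ENNReal.ofReal_mul (p := 1 / (1 + s ^ 2)) (by positivity)]
    rw [lintegral_const_mul' _ _ (by simp), lintegral_const_mul' _ _ (by simp),
      lintegral_inv_mul_sqrt hs, lintegral_Ioo_inv_one_add_sq_mul_sq hs,
      ENNReal.ofReal_mul zero_le_two, ENNReal.ofReal_ofNat, mul_left_comm]
  rw [lintegral_congr_ae h1, lintegral_const_mul' _ _ (by simp),
    lintegral_lintegral_swap (Measurable.aemeasurable (by unfold Function.uncurry; fun_prop)),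
    setLIntegral_congr_fun measurableSet_Ioo fun w hw ↦ lintegral_inv_mul_inv hw,
    lintegral_Ioo_inv_one_add, mul_assoc 2, ENNReal.ofReal_mul zero_le_two, ENNReal.ofReal_ofNat]

theorem lintegral_lintegral_cosh :
    ∫⁻ b, ∫⁻ c, ENNReal.ofReal (1 / ((cosh b + cosh c) * √(cosh b * cosh c)))
      = ENNReal.ofReal (2 * π * log 2) := by
  have key (a b : ℝ) : ENNReal.ofReal (1 / ((cosh (a + b) + cosh (a - b)) *
      √(cosh (a + b) * cosh (a - b)))) = ENNReal.ofReal (1 / 2) * (ENNReal.ofReal (cosh b) *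
      (ENNReal.ofReal (cosh a) * ENNReal.ofReal (1 / ((1 + sinh b ^ 2) * ((1 + sinh a ^ 2) *
        √(1 + sinh b ^ 2 + sinh a ^ 2)))))) := by
    rw [← ENNReal.ofReal_mul (by positivity), ← ENNReal.ofReal_mul (by positivity),
      ← ENNReal.ofReal_mul (by positivity)]
    have h1 : cosh (a + b) * cosh (a - b) = 1 + sinh b ^ 2 + sinh a ^ 2 := by
      rw [cosh_add, cosh_sub]
      linear_combination cosh b ^ 2 * cosh_sq a + (1 + sinh a ^ 2) * cosh_sq b
    have h2 : cosh (a + b) + cosh (a - b) = 2 * cosh a * cosh b := by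
      rw [cosh_add, cosh_sub]; ring
    have h3 : 0 < √(1 + sinh b ^ 2 + sinh a ^ 2) := by positivity
    rw [h1, h2]
    generalize √(1 + sinh b ^ 2 + sinh a ^ 2) = r at *
    rw [add_comm 1, add_comm 1, ← cosh_sq, ← cosh_sq]
    congr 1
    have := cosh_pos a
    have := cosh_pos b
    field_simp
  rw [lintegral_lintegral_add_sub (by unfold Function.uncurry; fun_prop)]
  simp_rw [key]
  have h2 (b : ℝ) : ∫⁻ a, ENNReal.ofReal (1 / 2) * (ENNReal.ofReal (cosh b) *
      (ENNReal.ofReal (cosh a) * ENNReal.ofReal (1 / ((1 + sinh b ^ 2) * ((1 + sinh a ^ 2) *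
        √(1 + sinh b ^ 2 + sinh a ^ 2)))))) = ENNReal.ofReal (1 / 2) * (ENNReal.ofReal (cosh b) *
      ∫⁻ v, ENNReal.ofReal (1 / ((1 + sinh b ^ 2) * ((1 + v ^ 2) *
        √(1 + sinh b ^ 2 + v ^ 2))))) := by
    rw [lintegral_const_mul' _ _ (by simp), lintegral_const_mul' _ _ (by simp),
      lintegral_comp_of_bijective hasDerivAt_sinh (fun x ↦ (cosh_pos x).le) sinh_bijective
      (fun v ↦ ENNReal.ofReal (1 / ((1 + sinh b ^ 2) * ((1 + v ^ 2) *
        √(1 + sinh b ^ 2 + v ^ 2)))))]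
  simp_rw [h2]
  rw [lintegral_const_mul' _ _ (by simp), lintegral_comp_of_bijective hasDerivAt_sinh
    (fun x ↦ (cosh_pos x).le) sinh_bijective (fun s ↦ ∫⁻ v, ENNReal.ofReal (1 / ((1 + s ^ 2) *
      ((1 + v ^ 2) * √(1 + s ^ 2 + v ^ 2))))), lintegral_lintegral_inv_mul_sqrt,
    ← ENNReal.ofReal_mul (by norm_num), ← ENNReal.ofReal_ofNat, ← ENNReal.ofReal_mul (by norm_num)]
  congr 1
  ring

theorem lintegral_mul_lintegralExpCosh_pow_four :
    ∫⁻ x in Set.Ioi (0 : ℝ), ENNReal.ofReal x * lintegralExpCosh x ^ 4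
      = ENNReal.ofReal (4 * π ^ 2 * log 2) := by
  have h1 (x : ℝ) (hx : x ∈ Set.Ioi (0 : ℝ)) : ENNReal.ofReal x * lintegralExpCosh x ^ 4 =
      ∫⁻ b, ∫⁻ c, ENNReal.ofReal (4 * π / √(cosh b * cosh c)) *
        ENNReal.ofReal (exp (-(2 * (cosh b + cosh c)) * x)) := by
    have hx : 0 < x := hx
    rw [show 4 = 2 * 2 from rfl, pow_mul, lintegralExpCosh_sq hx, mul_pow, sq (lintegral _ _),
      ← lintegral_lintegral_mul (by fun_prop) (by fun_prop), ← mul_assoc,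
      ← ENNReal.ofReal_ofNat, ← ENNReal.ofReal_pow (by norm_num), ← ENNReal.ofReal_mul hx.le,
      ← lintegral_const_mul' _ _ (by simp)]
    refine lintegral_congr fun b ↦ ?_
    rw [← lintegral_const_mul' _ _ (by simp)]
    refine lintegral_congr fun c ↦ ?_
    rw [← ENNReal.ofReal_mul (by positivity), ← ENNReal.ofReal_mul (by positivity),
      ← ENNReal.ofReal_mul (by positivity)]
    have hb := cosh_pos b
    have hc := cosh_pos c
    have : π / (x * cosh b) * (π / (x * cosh c)) = (π / x) ^ 2 / (cosh b * cosh c) := by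
      field_simp
    rw [show ∀ A B E G : ℝ, x * 2 ^ 2 * (A * E * (B * G)) = 4 * x * (A * B) * (E * G) by
      intros; ring, ← exp_add, ← sqrt_mul (by positivity), this,
      sqrt_div (by positivity), sqrt_sq (by positivity)]
    have h3 : 0 < √(cosh b * cosh c) := by positivity
    rw [show -(2 * x * cosh b) + -(2 * x * cosh c) = -(2 * (cosh b + cosh c)) * x by ring]
    congr 1
    field_simp
  have hm : Measurable fun p : (ℝ × ℝ) × ℝ ↦ ENNReal.ofReal (4 * π / √(cosh p.1.2 * cosh p.2)) *
        ENNReal.ofReal (exp (-(2 * (cosh p.1.2 + cosh p.2)) * p.1.1)) := by fun_prop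
  rw [setLIntegral_congr_fun measurableSet_Ioi h1,
    lintegral_lintegral_swap hm.lintegral_prod_right'.aemeasurable]
  have h2 (b : ℝ) : ∫⁻ x in Set.Ioi (0 : ℝ), ∫⁻ c, ENNReal.ofReal (4 * π / √(cosh b * cosh c)) *
        ENNReal.ofReal (exp (-(2 * (cosh b + cosh c)) * x)) = ENNReal.ofReal (2 * π) *
      ∫⁻ c, ENNReal.ofReal (1 / ((cosh b + cosh c) * √(cosh b * cosh c))) := by
    rw [lintegral_lintegral_swap (Measurable.aemeasurable (by unfold Function.uncurry; fun_prop)),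
      ← lintegral_const_mul' _ _ ENNReal.ofReal_ne_top]
    refine lintegral_congr fun c ↦ ?_
    rw [lintegral_const_mul' _ _ (by simp), lintegral_exp_neg_mul_Ioi (by positivity),
      ← ENNReal.ofReal_mul (by positivity), ← ENNReal.ofReal_mul (by positivity)]
    congr 1
    have hb := cosh_pos b
    have hc := cosh_pos c
    have h3 : 0 < √(cosh b * cosh c) := by positivity
    field_simp
    norm_num
  simp_rw [h2]
  rw [lintegral_const_mul' _ _ ENNReal.ofReal_ne_top, lintegral_lintegral_cosh,
    ← ENNReal.ofReal_mul (by positivity)]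
  congr 1
  ring

theorem integral_mul_besselK_one_div_four_pow_four :
    ∫ x in Set.Ioi (0 : ℝ), x * besselK (1 / 4) x ^ 4 = π ^ 2 / 4 * log 2 := by
  have h1 : ∀ x ∈ Set.Ioi (0 : ℝ), x * besselK (1 / 4) x ^ 4 =
      (ENNReal.ofReal x * lintegralExpCosh x ^ 4).toReal / 16 := fun x hx ↦ by
    rw [besselK_one_div_four, ENNReal.toReal_mul, ENNReal.toReal_pow,
      ENNReal.toReal_ofReal (le_of_lt hx)]
    ring
  have hm : Measurable fun x ↦ ENNReal.ofReal x * lintegralExpCosh x ^ 4 :=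
    ENNReal.measurable_ofReal.mul (measurable_lintegralExpCosh.pow_const 4)
  have h := lintegral_mul_lintegralExpCosh_pow_four
  rw [setIntegral_congr_fun measurableSet_Ioi h1, integral_div,
    integral_toReal hm.aemeasurable (ae_lt_top hm (by rw [h]; exact ENNReal.ofReal_ne_top)), h,
    ENNReal.toReal_ofReal (mul_nonneg (by positivity) (log_nonneg one_le_two))]
  ring

theorem stmt9 (a : ℝ) (ha : 0 < a) :
    (∫ x in Set.Ioi (0:ℝ), x * (besselK (1 / 4) (a * x)) ^ 4)
    = (π ^ 2 / (4 * a ^ 2)) * Real.log 2 := by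
  have h := integral_comp_mul_left_Ioi (fun y ↦ y * besselK (1 / 4) y ^ 4) 0 ha
  simp only [mul_zero, smul_eq_mul, mul_assoc a] at h
  rw [integral_const_mul, integral_mul_besselK_one_div_four_pow_four] at h
  field_simp at h ⊢
  linarith
end

section
/- Let a > 0 be real and let α be a real number with −1/2 < α < 1 and α ≠ 0. Then ∫₀^∞ x I_α(a x) K_α³(a x) dx = (π/(8a²)) csc(πα) · { ψ(1/2 + α) + 2 ln 2 + γ }. -/
open MeasureTheory Real

noncomputable def besselI (ν x : ℝ) : ℝ :=
  ∑' k : ℕ, (1 / ((k.factorial : ℝ) * Real.Gamma ((k : ℝ) + ν + 1))) * (x / 2) ^ (2 * (k : ℝ) + ν)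
noncomputable def digamma (x : ℝ) : ℝ := deriv (fun y => Real.log (Real.Gamma y)) x

lemma differentiableAt_log_Gamma {x : ℝ} (hx : 0 < x) :
    DifferentiableAt ℝ (fun y => Real.log (Real.Gamma y)) x :=
  (differentiableAt_Gamma fun m => by
    have : (0 : ℝ) ≤ m := m.cast_nonneg
    linarith).log (Gamma_pos_of_pos hx).ne'

lemma digamma_add_one {x : ℝ} (hx : 0 < x) : digamma (x + 1) = digamma x + 1 / x := by
  unfold digamma
  rw [← deriv_comp_add_const, one_div, ← deriv_log,
    ← deriv_fun_add (differentiableAt_log_Gamma hx) (differentiableAt_log hx.ne')]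
  apply Filter.EventuallyEq.deriv_eq
  filter_upwards [eventually_gt_nhds hx] with y hy
  rw [Gamma_add_one hy.ne', log_mul hy.ne' (Gamma_pos_of_pos hy).ne', add_comm]

lemma digamma_add_natCast {x : ℝ} (hx : 0 < x) (N : ℕ) :
    digamma (x + N) = digamma x + ∑ n ∈ Finset.range N, 1 / (n + x) := by
  induction N with
  | zero => simp
  | succ N ih =>
    rw [Finset.sum_range_succ, ← add_assoc, ← ih, Nat.cast_succ, ← add_assoc,
      digamma_add_one (by positivity), add_comm (N : ℝ) x]

lemma digamma_le_log {x : ℝ} (hx : 0 < x) : digamma x ≤ log x := by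
  have h := convexOn_log_Gamma.deriv_le_slope (Set.mem_Ioi.2 hx)
    (Set.mem_Ioi.2 (by positivity : 0 < x + 1)) (by linarith) (differentiableAt_log_Gamma hx)
  have e : slope (log ∘ Gamma) x (x + 1) = log x := by
    simp only [slope_def_field, Function.comp_apply]
    rw [Gamma_add_one hx.ne', log_mul hx.ne' (Gamma_pos_of_pos hx).ne']
    ring
  rw [e] at h
  exact h

lemma log_le_digamma_add_one {x : ℝ} (hx : 0 < x) : log x ≤ digamma (x + 1) := by
  have h := convexOn_log_Gamma.slope_le_deriv (Set.mem_Ioi.2 hx)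
    (Set.mem_Ioi.2 (by positivity : 0 < x + 1)) (by linarith)
    (differentiableAt_log_Gamma (by positivity))
  have e : slope (log ∘ Gamma) x (x + 1) = log x := by
    simp only [slope_def_field, Function.comp_apply]
    rw [Gamma_add_one hx.ne', log_mul hx.ne' (Gamma_pos_of_pos hx).ne']
    ring
  rw [e] at h
  exact h

lemma tendsto_digamma_sub_log {x : ℝ} (hx : 0 < x) :
    Filter.Tendsto (fun N : ℕ => digamma (x + N) - log N) Filter.atTop (nhds 0) := by
  have h0 : Filter.Tendsto (fun N : ℕ => log (1 + x / N)) Filter.atTop (nhds 0) := by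
    have := (tendsto_const_div_atTop_nhds_zero_nat x).const_add 1
    simpa using (this.log (by norm_num))
  have h1 : Filter.Tendsto (fun N : ℕ => 1 / (x + N)) Filter.atTop (nhds 0) :=
    tendsto_const_nhds.div_atTop (Filter.tendsto_atTop_add_const_left _ _
      tendsto_natCast_atTop_atTop)
  have hlog : ∀ N : ℕ, 0 < N → log (x + N) = log N + log (1 + x / N) := fun N hN => by
    have : (0 : ℝ) < N := by exact_mod_cast hN
    rw [← log_mul (by positivity) (by positivity)]
    congr 1
    field_simp
    ring
  refine tendsto_of_tendsto_of_tendsto_of_le_of_le' (by simpa only [sub_zero] using h0.sub h1) h0 ?_ ?_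
  · filter_upwards [Filter.eventually_gt_atTop 0] with N hN
    have hp : 0 < x + N := by positivity
    have := log_le_digamma_add_one hp
    rw [digamma_add_one hp, hlog N hN] at this
    linarith
  · filter_upwards [Filter.eventually_gt_atTop 0] with N hN
    have := digamma_le_log (x := x + N) (by positivity)
    rw [hlog N hN] at this
    linarith

lemma tendsto_sum_digamma_sub {x y : ℝ} (hx : 0 < x) (hy : 0 < y) :
    Filter.Tendsto (fun N : ℕ => ∑ n ∈ Finset.range N, (1 / (n + y) - 1 / (n + x)))
      Filter.atTop (nhds (digamma x - digamma y)) := by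
  have h := ((tendsto_digamma_sub_log hy).sub (tendsto_digamma_sub_log hx)).const_add
    (digamma x - digamma y)
  simp only [sub_zero, add_zero] at h
  refine h.congr fun N => ?_
  rw [digamma_add_natCast hx, digamma_add_natCast hy, Finset.sum_sub_distrib]
  ring

lemma digamma_one_half : digamma (1 / 2) = -(2 * log 2) - eulerMascheroniConstant := by
  unfold digamma
  rw [(hasDerivAt_Gamma_one_half.log (by rw [Gamma_one_half_eq]; positivity)).deriv,
    Gamma_one_half_eq]
  field_simp
  ring

lemma lintegral_Ioi_eq_lintegral_exp (f : ℝ → ENNReal) :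
    ∫⁻ x in Set.Ioi (0 : ℝ), f x = ∫⁻ t : ℝ, ENNReal.ofReal (exp t) * f (exp t) := by
  have h := lintegral_image_eq_lintegral_abs_deriv_mul (s := Set.univ) (f := exp) (f' := exp)
    MeasurableSet.univ (fun x _ => (hasDerivAt_exp x).hasDerivWithinAt) exp_injective.injOn f
  simpa [Set.image_univ, range_exp] using h

lemma lintegral_exp_sub_mul_exp {s c : ℝ} (hs : 0 < s) (hc : 0 < c) :
    ∫⁻ t : ℝ, ENNReal.ofReal (exp (s * t - c * exp t))
      = ENNReal.ofReal (Gamma s * c ^ (-s)) := by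
  have hval := integral_rpow_mul_exp_neg_mul_Ioi hs hc
  have hpos : 0 < (1 / c) ^ s * Gamma s := by have := Gamma_pos_of_pos hs; positivity
  have hint : IntegrableOn (fun t : ℝ => t ^ (s - 1) * exp (-(c * t))) (Set.Ioi 0) := by
    by_contra h
    rw [integral_undef h] at hval
    exact hpos.ne hval
  have h := ofReal_integral_eq_lintegral_ofReal hint
    ((ae_restrict_mem measurableSet_Ioi).mono fun t (ht : 0 < t) => by positivity)
  rw [hval, lintegral_Ioi_eq_lintegral_exp] at h
  rw [rpow_neg hc.le, ← inv_rpow hc.le, mul_comm, ← one_div, h]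
  refine lintegral_congr fun t => ?_
  rw [← ENNReal.ofReal_mul (exp_pos t).le, ← exp_mul, ← exp_add, ← exp_add]
  congr 2
  ring

lemma lintegral_rpow_mul_exp_neg_mul_sq {s β : ℝ} (hs : 0 < s) (hβ : 0 < β) :
    ∫⁻ x in Set.Ioi (0 : ℝ), ENNReal.ofReal (x ^ (2 * s - 1) * exp (-β * x ^ 2))
      = ENNReal.ofReal (Gamma s * β ^ (-s) / 2) := by
  have hval := integral_rpow_mul_exp_neg_mul_rpow (p := 2) (q := 2 * s - 1) two_pos
    (by linarith) hβ
  rw [show -(2 * s - 1 + 1) / 2 = -s by ring, show (2 * s - 1 + 1) / 2 = s by ring] at hval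
  simp only [rpow_two] at hval
  have hpos : 0 < β ^ (-s) * (1 / 2) * Gamma s := by have := Gamma_pos_of_pos hs; positivity
  have hint : IntegrableOn (fun x : ℝ => x ^ (2 * s - 1) * exp (-β * x ^ 2)) (Set.Ioi 0) := by
    by_contra h
    rw [integral_undef h] at hval
    exact hpos.ne hval
  rw [← ofReal_integral_eq_lintegral_ofReal hint
    ((ae_restrict_mem measurableSet_Ioi).mono fun t (ht : 0 < t) => by positivity), hval]
  congr 1
  ring

lemma integrable_exp_neg_mul_cosh {x : ℝ} (hx : 0 < x) (ν : ℝ) :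
    Integrable fun t : ℝ => exp (-x * cosh t + ν * t) := by
  have h : Integrable fun t : ℝ => exp (-(x / 4) * t ^ 2 + ν * t) := by
    have := (integrable_cexp_quadratic' (b := ((-(x / 4) : ℝ) : ℂ))
      (by rw [Complex.ofReal_re]; linarith) (ν : ℂ) 0).norm
    refine this.congr (Filter.Eventually.of_forall fun t => ?_)
    simp only [Complex.norm_exp]
    congr 1
    norm_cast
    simp
  refine h.mono' (by fun_prop) (Filter.Eventually.of_forall fun t => ?_)
  rw [norm_of_nonneg (exp_pos _).le, exp_le_exp]
  have h2 : t ^ 2 / 4 ≤ cosh t := by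
    rw [← cosh_abs, cosh_eq, ← sq_abs]
    have := quadratic_le_exp_of_nonneg (abs_nonneg t)
    have := exp_pos (-|t|)
    have := abs_nonneg t
    linarith
  nlinarith

lemma ofReal_two_mul_besselK {x : ℝ} (hx : 0 < x) (ν : ℝ) :
    ENNReal.ofReal (2 * besselK ν x) = ∫⁻ t : ℝ, ENNReal.ofReal (exp (-x * cosh t + ν * t)) := by
  have hi := integrable_exp_neg_mul_cosh hx ν
  have hi' := integrable_exp_neg_mul_cosh hx (-ν)
  rw [← ofReal_integral_eq_lintegral_ofReal hi (Filter.Eventually.of_forall fun _ => (exp_pos _).le)]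
  congr 1
  rw [← intervalIntegral.integral_Iic_add_Ioi (b := 0) hi.integrableOn hi.integrableOn]
  have hneg : ∫ t in Set.Iic (0 : ℝ), exp (-x * cosh t + ν * t)
      = ∫ t in Set.Ioi (0 : ℝ), exp (-x * cosh t + -ν * t) := by
    rw [← neg_zero, ← integral_comp_neg_Iic]
    simp
  rw [hneg, ← integral_add hi'.integrableOn hi.integrableOn, besselK, ← integral_const_mul]
  congr 1 with t
  rw [exp_add, exp_add, cosh_eq (ν * t), neg_mul ν]
  ring

lemma besselK_nonneg (ν x : ℝ) : 0 ≤ besselK ν x :=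
  integral_nonneg fun _ => mul_nonneg (exp_pos _).le (cosh_pos _).le

lemma measurable_besselK (ν : ℝ) : Measurable (besselK ν) := by
  unfold besselK
  refine (StronglyMeasurable.integral_prod_right
    (f := fun x t => exp (-x * cosh t) * cosh (ν * t)) ?_).measurable
  apply Continuous.stronglyMeasurable
  fun_prop

lemma besselI_term_nonneg {ν : ℝ} (hν : -1 < ν) {x : ℝ} (hx : 0 < x) (k : ℕ) :
    0 ≤ (1 / ((k.factorial : ℝ) * Gamma ((k : ℝ) + ν + 1))) * (x / 2) ^ (2 * (k : ℝ) + ν) := by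
  have : 0 < Gamma ((k : ℝ) + ν + 1) :=
    Gamma_pos_of_pos (by have : (0 : ℝ) ≤ k := k.cast_nonneg; linarith)
  positivity

lemma lintegral_besselI_term {ν B : ℝ} (hν : -1 < ν) (hB : 0 < B) (k : ℕ) :
    ∫⁻ x in Set.Ioi (0 : ℝ), ENNReal.ofReal (x ^ (1 + ν) * exp (-(B / 2) * x ^ 2)) *
        ENNReal.ofReal ((1 / ((k.factorial : ℝ) * Gamma ((k : ℝ) + ν + 1))) *
          (x / 2) ^ (2 * (k : ℝ) + ν))
      = ENNReal.ofReal (B ^ (-ν - 1) * ((1 / (2 * B)) ^ k / k.factorial)) := by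
  have hs : 0 < (k : ℝ) + ν + 1 := by have : (0 : ℝ) ≤ k := k.cast_nonneg; linarith
  have hG := Gamma_pos_of_pos hs
  have h := lintegral_rpow_mul_exp_neg_mul_sq hs (half_pos hB)
  have hc : 0 ≤ (1 / ((k.factorial : ℝ) * Gamma ((k : ℝ) + ν + 1))) *
      (1 / 2) ^ (2 * (k : ℝ) + ν) := by positivity
  calc _ = ∫⁻ x in Set.Ioi (0 : ℝ), ENNReal.ofReal ((1 / ((k.factorial : ℝ) *
        Gamma ((k : ℝ) + ν + 1))) * (1 / 2) ^ (2 * (k : ℝ) + ν)) *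
        ENNReal.ofReal (x ^ (2 * ((k : ℝ) + ν + 1) - 1) * exp (-(B / 2) * x ^ 2)) := by
        refine setLIntegral_congr_fun measurableSet_Ioi fun x (hx : 0 < x) => ?_
        rw [← ENNReal.ofReal_mul (by positivity), ← ENNReal.ofReal_mul hc]
        congr 1
        rw [show 2 * ((k : ℝ) + ν + 1) - 1 = (1 + ν) + (2 * (k : ℝ) + ν) by ring,
          rpow_add hx (1 + ν), div_eq_mul_one_div x 2, mul_rpow hx.le (by norm_num)]
        ring
    _ = _ := by
        rw [lintegral_const_mul _ (by fun_prop), h, ← ENNReal.ofReal_mul hc]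
        congr 1
        have e1 : (1 / 2 : ℝ) ^ (2 * (k : ℝ) + ν) * (1 / 2) ^ (-((k : ℝ) + ν + 1))
            = (1 / 2) ^ k * 2 := by
          rw [← rpow_add (by norm_num), show 2 * (k : ℝ) + ν + -((k : ℝ) + ν + 1) = k + -1 by ring,
            rpow_add (by norm_num), rpow_natCast, rpow_neg_one]
          norm_num
        have e2 : B ^ (-((k : ℝ) + ν + 1)) = B ^ (-ν - 1) * (1 / B) ^ k := by
          rw [show -((k : ℝ) + ν + 1) = (-ν - 1) - k by ring, rpow_sub hB, rpow_natCast,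
            one_div, inv_pow, div_eq_mul_inv]
        rw [div_eq_mul_one_div B 2, mul_rpow hB.le (by norm_num), e2,
          show 1 / (2 * B) = 1 / 2 * (1 / B) by ring, mul_pow]
        have hf : (0 : ℝ) < k.factorial := by positivity
        calc _ = (1 / k.factorial) * (Gamma (k + ν + 1) / Gamma (k + ν + 1)) *
              ((1 / 2 : ℝ) ^ (2 * (k : ℝ) + ν) * (1 / 2) ^ (-((k : ℝ) + ν + 1))) *
              (B ^ (-ν - 1) * (1 / B) ^ k) / 2 := by field_simp
          _ = _ := by
            rw [e1, div_self hG.ne']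
            ring

lemma lintegral_tsum_besselI_term {ν B : ℝ} (hν : -1 < ν) (hB : 0 < B) :
    ∫⁻ x in Set.Ioi (0 : ℝ), ENNReal.ofReal (x ^ (1 + ν) * exp (-(B / 2) * x ^ 2)) *
        ∑' k : ℕ, ENNReal.ofReal ((1 / ((k.factorial : ℝ) * Gamma ((k : ℝ) + ν + 1))) *
          (x / 2) ^ (2 * (k : ℝ) + ν))
      = ENNReal.ofReal (B ^ (-ν - 1) * exp (1 / (2 * B))) := by
  have hsum : HasSum (fun k : ℕ => B ^ (-ν - 1) * ((1 / (2 * B)) ^ k / k.factorial))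
      (B ^ (-ν - 1) * exp (1 / (2 * B))) := by
    have := (NormedSpace.expSeries_div_hasSum_exp (1 / (2 * B) : ℝ)).mul_left (B ^ (-ν - 1))
    rwa [← exp_eq_exp_ℝ] at this
  simp_rw [← ENNReal.tsum_mul_left]
  rw [lintegral_tsum (fun k => by fun_prop)]
  simp_rw [lintegral_besselI_term hν hB]
  rw [← hsum.tsum_eq, ENNReal.ofReal_tsum_of_nonneg (fun k => by positivity) hsum.summable]

lemma besselI_ae_eq {ν : ℝ} (hν : -1 < ν) :
    ∀ᵐ x ∂(volume.restrict (Set.Ioi (0 : ℝ))),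
      ENNReal.ofReal (besselI ν x) = (∑' k : ℕ, ENNReal.ofReal
        ((1 / ((k.factorial : ℝ) * Gamma ((k : ℝ) + ν + 1))) * (x / 2) ^ (2 * (k : ℝ) + ν))) ∧
      0 ≤ besselI ν x := by
  have h := lintegral_tsum_besselI_term hν one_pos
  have hae := ae_lt_top (by fun_prop) (h.trans_ne ENNReal.ofReal_ne_top)
  filter_upwards [hae, ae_restrict_mem measurableSet_Ioi] with x hx (hx0 : 0 < x)
  have hpos : 0 < x ^ (1 + ν) * exp (-(1 / 2) * x ^ 2) := by positivity
  have hfin := (ENNReal.lt_top_of_mul_ne_top_right hx.ne (by simpa using hpos)).ne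
  have hsum : Summable fun k : ℕ =>
      (1 / ((k.factorial : ℝ) * Gamma ((k : ℝ) + ν + 1))) * (x / 2) ^ (2 * (k : ℝ) + ν) := by
    refine (ENNReal.summable_toReal hfin).congr fun k => ?_
    exact ENNReal.toReal_ofReal (besselI_term_nonneg hν hx0 k)
  exact ⟨ENNReal.ofReal_tsum_of_nonneg (besselI_term_nonneg hν hx0) hsum,
    tsum_nonneg (besselI_term_nonneg hν hx0)⟩

lemma aestronglyMeasurable_besselI {ν : ℝ} (hν : -1 < ν) :
    AEStronglyMeasurable (besselI ν) (volume.restrict (Set.Ioi (0 : ℝ))) := by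
  refine AEMeasurable.aestronglyMeasurable ⟨fun x => (∑' k : ℕ, ENNReal.ofReal
    ((1 / ((k.factorial : ℝ) * Gamma ((k : ℝ) + ν + 1))) * (x / 2) ^ (2 * (k : ℝ) + ν))).toReal,
    by fun_prop, ?_⟩
  filter_upwards [besselI_ae_eq hν] with x hx
  rw [← hx.1, ENNReal.toReal_ofReal hx.2]

lemma ofReal_two_mul_besselK_eq_rpow_mul {x : ℝ} (hx : 0 < x) (ν : ℝ) :
    ENNReal.ofReal (2 * besselK ν x) = ENNReal.ofReal (x ^ ν) *
      ∫⁻ τ : ℝ, ENNReal.ofReal (exp (ν * τ - exp (-τ) / 2 - exp τ / 2 * x ^ 2)) := by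
  rw [ofReal_two_mul_besselK hx, ← lintegral_const_mul _ (by fun_prop),
    ← lintegral_add_right_eq_self _ (log x)]
  refine lintegral_congr fun τ => ?_
  rw [← ENNReal.ofReal_mul (by positivity), rpow_def_of_pos hx, ← exp_add, cosh_eq, neg_add,
    exp_add τ, exp_add (-τ), exp_neg (log x), exp_log hx]
  congr 2
  field_simp
  ring

lemma ofReal_four_mul_besselK_sq {x : ℝ} (hx : 0 < x) (ν : ℝ) :
    ENNReal.ofReal (4 * besselK ν x ^ 2) = ∫⁻ p : ℝ, ∫⁻ σ : ℝ,
      ENNReal.ofReal (exp (ν * p - exp (-σ) * (1 + cosh p) - exp σ / 2 * x ^ 2)) := by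
  have hK : 0 ≤ 2 * besselK ν x := mul_nonneg two_pos.le (besselK_nonneg ν x)
  calc _ = ENNReal.ofReal (2 * besselK ν x) * ENNReal.ofReal (2 * besselK ν x) := by
        rw [← ENNReal.ofReal_mul hK]
        congr 1
        ring
    _ = ∫⁻ a : ℝ, ∫⁻ b : ℝ, ENNReal.ofReal (exp (-x * cosh a + ν * a)) *
          ENNReal.ofReal (exp (-x * cosh b + ν * b)) := by
        rw [lintegral_lintegral_mul (by fun_prop) (by fun_prop), ofReal_two_mul_besselK hx]
    _ = ∫⁻ a : ℝ, ∫⁻ p : ℝ, ENNReal.ofReal (exp (-x * (cosh a + cosh (p - a)) + ν * p)) := by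
        refine lintegral_congr fun a => ?_
        rw [← lintegral_sub_right_eq_self _ a]
        refine lintegral_congr fun p => ?_
        rw [← ENNReal.ofReal_mul (exp_pos _).le, ← exp_add]
        congr 2
        ring
    _ = ∫⁻ p : ℝ, ∫⁻ a : ℝ, ENNReal.ofReal (exp (-x * (cosh a + cosh (p - a)) + ν * p)) :=
        lintegral_lintegral_swap (by fun_prop)
    _ = _ := by
        refine lintegral_congr fun p => ?_
        have hc : 0 < 2 * cosh (p / 2) := by have := cosh_pos (p / 2); positivity
        rw [← lintegral_add_right_eq_self _ (p / 2 + log (x / (2 * cosh (p / 2))))]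
        refine lintegral_congr fun σ => ?_
        congr 2
        have hcosh : 1 + cosh p = (2 * cosh (p / 2)) ^ 2 / 2 := by
          have h1 := cosh_two_mul (p / 2)
          have h2 := cosh_sq (p / 2)
          rw [show 2 * (p / 2) = p by ring] at h1
          linarith
        have hsum : ∀ t : ℝ, cosh (t + p / 2) + cosh (p - (t + p / 2))
            = 2 * cosh (p / 2) * cosh t := fun t => by
          rw [show p - (t + p / 2) = p / 2 - t by ring, add_comm t, cosh_add, cosh_sub]
          ring
        rw [show σ + (p / 2 + log (x / (2 * cosh (p / 2))))
            = σ + log (x / (2 * cosh (p / 2))) + p / 2 by ring, hsum, hcosh]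
        generalize 2 * cosh (p / 2) = c at hc
        rw [cosh_eq, neg_add, exp_add σ, exp_add (-σ), exp_neg (log (x / c)),
          exp_log (by positivity)]
        field_simp
        ring

lemma lintegral_mul_besselK_cube {ν : ℝ} {S : ℝ → ENNReal} {Φ : ℝ → ℝ} (hS : Measurable S)
    (hΦ : ∀ B, 0 < B → ∫⁻ x in Set.Ioi (0 : ℝ),
      ENNReal.ofReal (x ^ (1 + ν) * exp (-(B / 2) * x ^ 2)) * S x = ENNReal.ofReal (Φ B)) :
    ∫⁻ x in Set.Ioi (0 : ℝ), ENNReal.ofReal x * S x * ENNReal.ofReal (8 * besselK ν x ^ 3)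
      = ∫⁻ p : ℝ, ∫⁻ σ : ℝ, ∫⁻ τ : ℝ,
        ENNReal.ofReal (exp (ν * p - exp (-σ) * (1 + cosh p) + (ν * τ - exp (-τ) / 2))) *
          ENNReal.ofReal (Φ (exp σ + exp τ)) := by
  calc _ = ∫⁻ x in Set.Ioi (0 : ℝ), ∫⁻ p : ℝ, ∫⁻ σ : ℝ, ∫⁻ τ : ℝ,
        ENNReal.ofReal (exp (ν * p - exp (-σ) * (1 + cosh p) + (ν * τ - exp (-τ) / 2))) *
          (ENNReal.ofReal (x ^ (1 + ν) * exp (-((exp σ + exp τ) / 2) * x ^ 2)) * S x) := by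
        refine setLIntegral_congr_fun measurableSet_Ioi fun x (hx : 0 < x) => ?_
        rw [show 8 * besselK ν x ^ 3 = (4 * besselK ν x ^ 2) * (2 * besselK ν x) by ring,
          ENNReal.ofReal_mul (by positivity), ofReal_four_mul_besselK_sq hx,
          ofReal_two_mul_besselK_eq_rpow_mul hx, ← lintegral_mul_const _ (by fun_prop),
          ← lintegral_const_mul _ (by fun_prop)]
        refine lintegral_congr fun p => ?_
        rw [← lintegral_mul_const _ (by fun_prop), ← lintegral_const_mul _ (by fun_prop)]
        refine lintegral_congr fun σ => ?_
        rw [← lintegral_const_mul _ (by fun_prop), ← lintegral_const_mul _ (by fun_prop),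
          ← lintegral_const_mul _ (by fun_prop)]
        refine lintegral_congr fun τ => ?_
        have hexp : exp (ν * p - exp (-σ) * (1 + cosh p) + (ν * τ - exp (-τ) / 2)) *
            (x ^ (1 + ν) * exp (-((exp σ + exp τ) / 2) * x ^ 2))
            = x * exp (ν * p - exp (-σ) * (1 + cosh p) - exp σ / 2 * x ^ 2) *
              (x ^ ν * exp (ν * τ - exp (-τ) / 2 - exp τ / 2 * x ^ 2)) := by
          have e : exp (ν * p - exp (-σ) * (1 + cosh p) + (ν * τ - exp (-τ) / 2)) *
              exp (-((exp σ + exp τ) / 2) * x ^ 2)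
              = exp (ν * p - exp (-σ) * (1 + cosh p) - exp σ / 2 * x ^ 2) *
                exp (ν * τ - exp (-τ) / 2 - exp τ / 2 * x ^ 2) := by
            rw [← exp_add, ← exp_add]
            congr 1
            ring
          rw [rpow_add hx, rpow_one]
          linear_combination x * x ^ ν * e
        rw [← mul_assoc (ENNReal.ofReal _) _ (S x), ← ENNReal.ofReal_mul (exp_pos _).le, hexp,
          ENNReal.ofReal_mul (by positivity), ENNReal.ofReal_mul hx.le,
          ENNReal.ofReal_mul (by positivity : 0 ≤ x ^ ν)]
        ring
    _ = _ := by
        rw [lintegral_lintegral_swap (by fun_prop)]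
        refine lintegral_congr fun p => ?_
        rw [lintegral_lintegral_swap (by fun_prop)]
        refine lintegral_congr fun σ => ?_
        rw [lintegral_lintegral_swap (by fun_prop)]
        refine lintegral_congr fun τ => ?_
        rw [lintegral_const_mul _ (by fun_prop), hΦ _ (by positivity)]

lemma exp_eq_sigmoid_div (ρ : ℝ) : exp ρ = sigmoid ρ / (1 - sigmoid ρ) := by
  have h1 := exp_pos (-ρ)
  rw [sigmoid_def, ← neg_neg ρ, exp_neg (-ρ), neg_neg]
  field_simp
  ring

lemma exp_mul_rpow_eq_sigmoid (ν p σ ρ : ℝ) :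
    exp (ν * p - exp (-σ) * (1 + cosh p) + (ν * (ρ + σ) - exp (-(ρ + σ)) / 2)) *
        ((exp σ + exp (ρ + σ)) ^ (-ν - 1) * exp (1 / (2 * (exp σ + exp (ρ + σ)))))
      = sigmoid ρ ^ ν * (1 - sigmoid ρ) * exp (ν * p) *
        exp (-σ - (cosh p + (sigmoid ρ + (sigmoid ρ)⁻¹) / 2) * exp (-σ)) := by
  have hw0 := sigmoid_pos ρ
  have hw1 : 0 < 1 - sigmoid ρ := sub_pos.2 (sigmoid_lt_one ρ)
  have hρ := exp_eq_sigmoid_div ρ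
  have hB : exp σ + exp (ρ + σ) = exp σ / (1 - sigmoid ρ) := by
    rw [exp_add, hρ]
    field_simp
    ring
  have hρν : exp (ν * ρ) = sigmoid ρ ^ ν / (1 - sigmoid ρ) ^ ν := by
    rw [← div_rpow hw0.le hw1.le, ← hρ, ← exp_mul, mul_comm]
  have hBν : (exp σ / (1 - sigmoid ρ)) ^ (-ν - 1)
      = exp (-ν * σ - σ) * ((1 - sigmoid ρ) ^ ν * (1 - sigmoid ρ)) := by
    rw [div_rpow (exp_pos σ).le hw1.le, ← exp_mul, show -ν - 1 = -(ν + 1) by ring,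
      rpow_neg hw1.le, div_inv_eq_mul, rpow_add hw1, rpow_one]
    congr 2
    ring
  have hinv : exp (-(ρ + σ)) = (1 - sigmoid ρ) / sigmoid ρ * exp (-σ) := by
    rw [neg_add, exp_add, exp_neg ρ, hρ, inv_div]
  have hinvB : 1 / (2 * (exp σ / (1 - sigmoid ρ))) = (1 - sigmoid ρ) / 2 * exp (-σ) := by
    rw [exp_neg]
    field_simp
  rw [hB, hBν, hinv, hinvB]
  generalize sigmoid ρ = w at *
  have hp : (1 - w) ^ ν ≠ 0 := (rpow_pos_of_pos hw1 ν).ne'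
  rw [eq_div_iff hp] at hρν
  calc _ = exp (ν * ρ) * (1 - w) ^ ν * (1 - w) *
        (exp (ν * p - exp (-σ) * (1 + cosh p) + (ν * σ - (1 - w) / w * exp (-σ) / 2)) *
          (exp (-ν * σ - σ) * exp ((1 - w) / 2 * exp (-σ)))) := by
        rw [show ν * p - exp (-σ) * (1 + cosh p) + (ν * (ρ + σ) - (1 - w) / w * exp (-σ) / 2)
          = ν * ρ + (ν * p - exp (-σ) * (1 + cosh p) + (ν * σ - (1 - w) / w * exp (-σ) / 2)) by
          ring, exp_add (ν * ρ)]
        ring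
    _ = _ := by
        rw [hρν, ← exp_add, ← exp_add, mul_assoc (w ^ ν * (1 - w)), ← exp_add]
        congr 2
        field_simp
        ring

lemma lintegral_sigmoid (f : ℝ → ENNReal) :
    ∫⁻ ρ : ℝ, ENNReal.ofReal (sigmoid ρ * (1 - sigmoid ρ)) * f (sigmoid ρ)
      = ∫⁻ w in Set.Ioo (0 : ℝ) 1, f w := by
  have h := lintegral_image_eq_lintegral_abs_deriv_mul (s := Set.univ) MeasurableSet.univ
    (fun x _ => (hasDerivAt_sigmoid x).hasDerivWithinAt) sigmoid_injective.injOn f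
  rw [Set.image_univ, range_sigmoid, Measure.restrict_univ] at h
  rw [h]
  refine lintegral_congr fun ρ => ?_
  rw [abs_of_pos (mul_pos (sigmoid_pos ρ) (sub_pos.2 (sigmoid_lt_one ρ)))]

lemma cosh_add_pos {w : ℝ} (hw : 0 < w) (p : ℝ) : 0 < cosh p + (w + w⁻¹) / 2 := by
  have := cosh_pos p
  positivity

lemma lintegral_triple_eq (ν : ℝ) :
    ∫⁻ p : ℝ, ∫⁻ σ : ℝ, ∫⁻ τ : ℝ,
        ENNReal.ofReal (exp (ν * p - exp (-σ) * (1 + cosh p) + (ν * τ - exp (-τ) / 2))) *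
          ENNReal.ofReal ((exp σ + exp τ) ^ (-ν - 1) * exp (1 / (2 * (exp σ + exp τ))))
      = ∫⁻ w in Set.Ioo (0 : ℝ) 1, ENNReal.ofReal (w ^ (ν - 1)) *
        ∫⁻ p : ℝ, ENNReal.ofReal (exp (ν * p) / (cosh p + (w + w⁻¹) / 2)) := by
  calc _ = ∫⁻ p : ℝ, ∫⁻ σ : ℝ, ∫⁻ ρ : ℝ,
        ENNReal.ofReal (sigmoid ρ ^ ν * (1 - sigmoid ρ) * exp (ν * p)) *
          ENNReal.ofReal (exp (-σ - (cosh p + (sigmoid ρ + (sigmoid ρ)⁻¹) / 2) * exp (-σ))) := by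
        refine lintegral_congr fun p => lintegral_congr fun σ => ?_
        rw [← lintegral_add_right_eq_self _ σ]
        refine lintegral_congr fun ρ => ?_
        have hw1 : 0 < 1 - sigmoid ρ := sub_pos.2 (sigmoid_lt_one ρ)
        have hw0 := sigmoid_pos ρ
        rw [← ENNReal.ofReal_mul (exp_pos _).le, exp_mul_rpow_eq_sigmoid,
          ENNReal.ofReal_mul (by positivity)]
    _ = ∫⁻ p : ℝ, ∫⁻ ρ : ℝ, ENNReal.ofReal (sigmoid ρ * (1 - sigmoid ρ)) *
          (ENNReal.ofReal (sigmoid ρ ^ (ν - 1)) *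
          ENNReal.ofReal (exp (ν * p) / (cosh p + (sigmoid ρ + (sigmoid ρ)⁻¹) / 2))) := by
        refine lintegral_congr fun p => ?_
        rw [lintegral_lintegral_swap (by fun_prop)]
        refine lintegral_congr fun ρ => ?_
        have hw1 : 0 < 1 - sigmoid ρ := sub_pos.2 (sigmoid_lt_one ρ)
        have hw0 := sigmoid_pos ρ
        have hC := cosh_add_pos hw0 p
        rw [lintegral_const_mul _ (by fun_prop)]
        have h := lintegral_exp_sub_mul_exp one_pos hC
        rw [← lintegral_neg_eq_self] at h
        simp only [one_mul, Gamma_one] at h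
        rw [h, ← ENNReal.ofReal_mul (by positivity), ← ENNReal.ofReal_mul (by positivity),
          ← ENNReal.ofReal_mul (by positivity), rpow_neg_one, rpow_sub_one hw0.ne']
        congr 1
        field_simp
    _ = _ := by
        rw [lintegral_lintegral_swap (by fun_prop), ← lintegral_sigmoid]
        refine lintegral_congr fun ρ => ?_
        rw [lintegral_const_mul _ (by fun_prop), lintegral_const_mul _ (by fun_prop)]

lemma lintegral_exp_div_add_exp {s c : ℝ} (hs0 : 0 < s) (hs1 : s < 1) (hc : 0 < c) :
    ∫⁻ t : ℝ, ENNReal.ofReal (exp (s * t) / (c + exp t))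
      = ENNReal.ofReal (π / sin (π * s) * c ^ (s - 1)) := by
  calc _ = ∫⁻ t : ℝ, ∫⁻ σ : ℝ, ENNReal.ofReal (exp (σ - c * exp σ)) *
        ENNReal.ofReal (exp (s * t - exp σ * exp t)) := by
        refine lintegral_congr fun t => ?_
        have h := lintegral_exp_sub_mul_exp one_pos (by positivity : 0 < c + exp t)
        rw [Gamma_one, one_mul, rpow_neg_one] at h
        rw [div_eq_mul_inv, ENNReal.ofReal_mul (exp_pos _).le, ← h,
          ← lintegral_const_mul _ (by fun_prop)]
        refine lintegral_congr fun σ => ?_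
        rw [← ENNReal.ofReal_mul (exp_pos _).le, ← ENNReal.ofReal_mul (exp_pos _).le, ← exp_add,
          ← exp_add]
        congr 2
        ring
    _ = ∫⁻ σ : ℝ, ENNReal.ofReal (Gamma s) *
        ENNReal.ofReal (exp ((1 - s) * σ - c * exp σ)) := by
        rw [lintegral_lintegral_swap (by fun_prop)]
        refine lintegral_congr fun σ => ?_
        rw [lintegral_const_mul _ (by fun_prop), lintegral_exp_sub_mul_exp hs0 (exp_pos σ),
          ← ENNReal.ofReal_mul (exp_pos _).le, ← ENNReal.ofReal_mul (Gamma_pos_of_pos hs0).le,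
          ← exp_mul, mul_left_comm, ← exp_add]
        congr 3
        ring
    _ = _ := by
        rw [lintegral_const_mul _ (by fun_prop), lintegral_exp_sub_mul_exp (by linarith) hc,
          ← ENNReal.ofReal_mul (Gamma_pos_of_pos hs0).le, ← mul_assoc, Gamma_mul_Gamma_one_sub,
          neg_sub]

lemma lintegral_exp_neg_div_cosh_add {μ w : ℝ} (hμ0 : 0 < μ) (hμ1 : μ < 1) (hw0 : 0 < w)
    (hw1 : w < 1) :
    ∫⁻ p : ℝ, ENNReal.ofReal (exp (-μ * p) / (cosh p + (w + w⁻¹) / 2))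
      = ENNReal.ofReal (2 * π / sin (π * μ) * ((w ^ (-μ) - w ^ μ) / (w⁻¹ - w))) := by
  have hd : 0 < w⁻¹ - w := sub_pos.2 (hw1.trans ((one_lt_inv₀ hw0).2 hw1))
  have hsin : 0 < sin (π * μ) :=
    sin_pos_of_pos_of_lt_pi (by positivity) (by nlinarith [pi_pos])
  have hsin' : sin (π * (1 - μ)) = sin (π * μ) := by
    rw [mul_sub, mul_one, sin_pi_sub]
  have key : ∀ c : ℝ, 0 < c →
      ∫⁻ p : ℝ, ENNReal.ofReal (2 / (w⁻¹ - w) * (exp ((1 - μ) * p) / (c + exp p)))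
        = ENNReal.ofReal (2 / (w⁻¹ - w) * (π / sin (π * μ) * c ^ (-μ))) := fun c hc => by
    have h := lintegral_exp_div_add_exp (s := 1 - μ) (by linarith) (by linarith) hc
    rw [hsin', show 1 - μ - 1 = -μ by ring] at h
    rw [ENNReal.ofReal_mul (by positivity), ← h, ← lintegral_const_mul _ (by fun_prop)]
    refine lintegral_congr fun p => ?_
    rw [ENNReal.ofReal_mul (by positivity)]
  have hadd : (∫⁻ p : ℝ, ENNReal.ofReal (exp (-μ * p) / (cosh p + (w + w⁻¹) / 2))) +
      ∫⁻ p : ℝ, ENNReal.ofReal (2 / (w⁻¹ - w) * (exp ((1 - μ) * p) / (w⁻¹ + exp p)))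
      = ∫⁻ p : ℝ, ENNReal.ofReal (2 / (w⁻¹ - w) * (exp ((1 - μ) * p) / (w + exp p))) := by
    rw [← lintegral_add_left (by fun_prop)]
    refine lintegral_congr fun p => ?_
    have hC := cosh_add_pos hw0 p
    rw [← ENNReal.ofReal_add (by positivity) (by positivity)]
    congr 1
    have he : exp (-μ * p) = exp ((1 - μ) * p) / exp p := by
      rw [← exp_sub]
      congr 1
      ring
    have hcosh : cosh p + (w + w⁻¹) / 2 = (exp p + w) * (exp p + w⁻¹) / (2 * exp p) := by
      rw [cosh_eq, exp_neg]
      field_simp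
      ring
    rw [he, hcosh]
    have h1 : w + exp p ≠ 0 := by positivity
    have h2 : w⁻¹ + exp p ≠ 0 := by positivity
    rw [add_comm (exp p) w, add_comm (exp p) w⁻¹]
    have h3 := hd.ne'
    have h4 := (exp_pos p).ne'
    generalize w⁻¹ = v at *
    field_simp
    ring
  rw [key _ (inv_pos.2 hw0), key _ hw0] at hadd
  rw [ENNReal.eq_sub_of_add_eq ENNReal.ofReal_ne_top hadd, ← ENNReal.ofReal_sub _ (by positivity),
    inv_rpow hw0.le, ← rpow_neg hw0.le, neg_neg]
  congr 1
  ring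

lemma lintegral_exp_div_cosh_add {ν w : ℝ} (hν0 : ν ≠ 0) (hν1 : -1 < ν) (hν2 : ν < 1)
    (hw0 : 0 < w) (hw1 : w < 1) :
    ∫⁻ p : ℝ, ENNReal.ofReal (exp (ν * p) / (cosh p + (w + w⁻¹) / 2))
      = ENNReal.ofReal (2 * π / sin (π * ν) * ((w ^ (-ν) - w ^ ν) / (w⁻¹ - w))) := by
  rcases hν0.lt_or_gt with h | h
  · have := lintegral_exp_neg_div_cosh_add (neg_pos.2 h) (by linarith) hw0 hw1
    rw [neg_neg] at this
    rw [this, mul_neg, sin_neg]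
    congr 1
    ring
  · have := lintegral_exp_neg_div_cosh_add h hν2 hw0 hw1
    rw [← this, ← lintegral_neg_eq_self]
    simp only [cosh_neg, mul_neg, neg_mul]

lemma sin_pi_mul_sign {ν : ℝ} (hν0 : ν ≠ 0) (hν1 : -1 < ν) (hν2 : ν < 1) :
    (0 < ν ∧ 0 < sin (π * ν)) ∨ (ν < 0 ∧ sin (π * ν) < 0) := by
  rcases hν0.lt_or_gt with h | h
  · refine Or.inr ⟨h, sin_neg_of_neg_of_neg_pi_lt (by nlinarith [pi_pos]) (by nlinarith [pi_pos])⟩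
  · exact Or.inl ⟨h, sin_pos_of_pos_of_lt_pi (by positivity) (by nlinarith [pi_pos])⟩

lemma lintegral_Ioo_rpow_sub_rpow {c r s : ℝ} (hr : -1 < r) (hs : -1 < s)
    (hnn : ∀ w ∈ Set.Ioo (0 : ℝ) 1, 0 ≤ c * (w ^ r - w ^ s)) :
    ∫⁻ w in Set.Ioo (0 : ℝ) 1, ENNReal.ofReal (c * (w ^ r - w ^ s))
      = ENNReal.ofReal (c * (1 / (r + 1) - 1 / (s + 1))) := by
  have hir := intervalIntegral.intervalIntegrable_rpow' (a := 0) (b := 1) hr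
  have his := intervalIntegral.intervalIntegrable_rpow' (a := 0) (b := 1) hs
  have hint := ((intervalIntegrable_iff_integrableOn_Ioo_of_le zero_le_one).1
    ((hir.sub his).const_mul c))
  rw [← ofReal_integral_eq_lintegral_ofReal hint ((ae_restrict_mem measurableSet_Ioo).mono hnn),
    ← integral_Ioc_eq_integral_Ioo, ← intervalIntegral.integral_of_le zero_le_one,
    intervalIntegral.integral_const_mul, intervalIntegral.integral_sub hir his,
    integral_rpow (Or.inl hr), integral_rpow (Or.inl hs), one_rpow, one_rpow,
    zero_rpow (by linarith), zero_rpow (by linarith), sub_zero]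

lemma digamma_series_eq {ν : ℝ} (hν0 : ν ≠ 0) (hν1 : -(1 / 2) < ν) (hν2 : ν < 1) :
    ∑' n : ℕ, ENNReal.ofReal (2 * π / sin (π * ν) *
        (1 / (2 * (n : ℝ) + 1) - 1 / (2 * (n : ℝ) + 2 * ν + 1)))
      = ENNReal.ofReal (π / sin (π * ν) * (digamma (1 / 2 + ν) - digamma (1 / 2))) ∧
    0 ≤ π / sin (π * ν) * (digamma (1 / 2 + ν) - digamma (1 / 2)) := by
  have hterm : ∀ n : ℕ, 2 * π / sin (π * ν) *
      (1 / (2 * (n : ℝ) + 1) - 1 / (2 * (n : ℝ) + 2 * ν + 1))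
      = π / sin (π * ν) * (1 / (n + 1 / 2) - 1 / (n + (1 / 2 + ν))) := fun n => by
    have hn : (0 : ℝ) ≤ n := n.cast_nonneg
    have h1 : 2 * (n : ℝ) + 2 * ν + 1 = 2 * (n + (1 / 2 + ν)) := by ring
    have h2 : 2 * (n : ℝ) + 1 = 2 * (n + 1 / 2) := by ring
    rw [h1, h2]
    simp only [one_div, mul_inv]
    ring
  have hnn : ∀ n : ℕ, 0 ≤ π / sin (π * ν) * (1 / (n + 1 / 2) - 1 / (n + (1 / 2 + ν))) := by
    intro n
    have hn : (0 : ℝ) ≤ n := n.cast_nonneg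
    rcases sin_pi_mul_sign hν0 (by linarith) hν2 with ⟨h, hs⟩ | ⟨h, hs⟩
    · refine mul_nonneg (by positivity) (sub_nonneg.2 ?_)
      exact one_div_le_one_div_of_le (by positivity) (by linarith)
    · refine mul_nonneg_of_nonpos_of_nonpos (div_nonpos_of_nonneg_of_nonpos pi_pos.le hs.le)
        (sub_nonpos.2 ?_)
      exact one_div_le_one_div_of_le (by linarith) (by linarith)
  have hsum : HasSum (fun n : ℕ => π / sin (π * ν) * (1 / (n + 1 / 2) - 1 / (n + (1 / 2 + ν))))
      (π / sin (π * ν) * (digamma (1 / 2 + ν) - digamma (1 / 2))) := by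
    rw [hasSum_iff_tendsto_nat_of_nonneg hnn]
    simp_rw [← Finset.mul_sum]
    exact (tendsto_sum_digamma_sub (by linarith) (by norm_num)).const_mul _
  simp_rw [hterm]
  exact ⟨by rw [← hsum.tsum_eq, ENNReal.ofReal_tsum_of_nonneg hnn hsum.summable],
    hsum.nonneg hnn⟩

lemma lintegral_Ioo_eq_digamma {ν : ℝ} (hν0 : ν ≠ 0) (hν1 : -(1 / 2) < ν) (hν2 : ν < 1) :
    ∫⁻ w in Set.Ioo (0 : ℝ) 1, ENNReal.ofReal (w ^ (ν - 1)) *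
        ∫⁻ p : ℝ, ENNReal.ofReal (exp (ν * p) / (cosh p + (w + w⁻¹) / 2))
      = ENNReal.ofReal (π / sin (π * ν) * (digamma (1 / 2 + ν) - digamma (1 / 2))) := by
  have hnn : ∀ (n : ℕ), ∀ w ∈ Set.Ioo (0 : ℝ) 1, 0 ≤ 2 * π / sin (π * ν) *
      (w ^ (2 * (n : ℝ)) - w ^ (2 * (n : ℝ) + 2 * ν)) := by
    intro n w ⟨hw0, hw1⟩
    rcases sin_pi_mul_sign hν0 (by linarith) hν2 with ⟨h, hs⟩ | ⟨h, hs⟩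
    · refine mul_nonneg (by positivity) (sub_nonneg.2 ?_)
      exact rpow_le_rpow_of_exponent_ge hw0 hw1.le (by linarith)
    · refine mul_nonneg_of_nonpos_of_nonpos
        (div_nonpos_of_nonneg_of_nonpos (by positivity) hs.le) (sub_nonpos.2 ?_)
      exact rpow_le_rpow_of_exponent_ge hw0 hw1.le (by linarith)
  calc _ = ∫⁻ w in Set.Ioo (0 : ℝ) 1, ∑' n : ℕ, ENNReal.ofReal (2 * π / sin (π * ν) *
        (w ^ (2 * (n : ℝ)) - w ^ (2 * (n : ℝ) + 2 * ν))) := by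
        refine setLIntegral_congr_fun measurableSet_Ioo fun w hw => ?_
        have hw0 : 0 < w := hw.1
        have hw2 : w ^ 2 < 1 := by nlinarith [hw.1, hw.2]
        have hsum : HasSum (fun n : ℕ => 2 * π / sin (π * ν) *
            (w ^ (2 * (n : ℝ)) - w ^ (2 * (n : ℝ) + 2 * ν)))
            (2 * π / sin (π * ν) * (1 - w ^ (2 * ν)) * (1 - w ^ 2)⁻¹) := by
          refine ((hasSum_geometric_of_lt_one (sq_nonneg w) hw2).mul_left
            (2 * π / sin (π * ν) * (1 - w ^ (2 * ν)))).congr_fun ?_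
          intro n
          rw [rpow_add hw0, rpow_mul hw0.le, rpow_two, rpow_natCast]
          ring
        rw [lintegral_exp_div_cosh_add hν0 (by linarith) hν2 hw.1 hw.2,
          ← ENNReal.ofReal_mul (by positivity), ← ENNReal.ofReal_tsum_of_nonneg
          (fun n => hnn n w hw) hsum.summable, hsum.tsum_eq]
        congr 1
        have h1 : (1 - w ^ 2) ≠ 0 := by linarith
        have h2 : w⁻¹ - w = (1 - w ^ 2) / w := by field_simp
        have h3 : w ^ ν ≠ 0 := (rpow_pos_of_pos hw0 ν).ne'
        rw [rpow_sub_one hw0.ne', rpow_neg hw0.le, h2, two_mul ν, rpow_add hw0]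
        field_simp
    _ = _ := by
        rw [lintegral_tsum (fun n => by fun_prop), ← (digamma_series_eq hν0 hν1 hν2).1]
        refine tsum_congr fun n => ?_
        have hn : (0 : ℝ) ≤ n := n.cast_nonneg
        exact lintegral_Ioo_rpow_sub_rpow (by linarith) (by linarith) (hnn n)

lemma integral_mul_besselI_mul_besselK_cube {ν : ℝ} (hν0 : ν ≠ 0) (hν1 : -(1 / 2) < ν)
    (hν2 : ν < 1) :
    ∫ x in Set.Ioi (0 : ℝ), x * besselI ν x * besselK ν x ^ 3
      = π / (8 * sin (π * ν)) * (digamma (1 / 2 + ν) - digamma (1 / 2)) := by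
  have hν : -1 < ν := by linarith
  have h := lintegral_mul_besselK_cube (ν := ν) (S := fun x => ∑' k : ℕ, ENNReal.ofReal
      ((1 / ((k.factorial : ℝ) * Gamma ((k : ℝ) + ν + 1))) * (x / 2) ^ (2 * (k : ℝ) + ν)))
    (Φ := fun B => B ^ (-ν - 1) * exp (1 / (2 * B))) (by fun_prop)
    (fun B hB => lintegral_tsum_besselI_term hν hB)
  rw [lintegral_triple_eq, lintegral_Ioo_eq_digamma hν0 hν1 hν2] at h
  have hK := besselK_nonneg ν
  have hae := besselI_ae_eq hν
  have hmem := ae_restrict_mem (μ := volume) (measurableSet_Ioi (a := (0 : ℝ)))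
  have h8 : ∫ x in Set.Ioi (0 : ℝ), x * besselI ν x * (8 * besselK ν x ^ 3)
      = π / sin (π * ν) * (digamma (1 / 2 + ν) - digamma (1 / 2)) := by
    rw [integral_eq_lintegral_of_nonneg_ae, ← ENNReal.toReal_ofReal (digamma_series_eq hν0 hν1 hν2).2,
      ← h]
    · congr 1
      refine lintegral_congr_ae ?_
      filter_upwards [hae, hmem] with x hx (hx0 : 0 < x)
      rw [← hx.1, ENNReal.ofReal_mul (mul_nonneg hx0.le hx.2), ENNReal.ofReal_mul hx0.le]
    · filter_upwards [hae, hmem] with x hx (hx0 : 0 < x)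
      have := hK x
      exact mul_nonneg (mul_nonneg hx0.le hx.2) (by positivity)
    · exact (measurable_id.aestronglyMeasurable.mul (aestronglyMeasurable_besselI hν)).mul
        (((measurable_besselK ν).pow_const 3).const_mul 8).aestronglyMeasurable
  have hsin : sin (π * ν) ≠ 0 := by
    rcases sin_pi_mul_sign hν0 hν hν2 with h | h
    exacts [h.2.ne', h.2.ne]
  rw [← mul_right_inj' (by norm_num : (8 : ℝ) ≠ 0), ← integral_const_mul]
  simp_rw [mul_left_comm (8 : ℝ) (_ * besselI ν _)]
  rw [h8]
  field_simp

theorem stmt11 (a α : ℝ) (ha : 0 < a) (hα1 : -(1 / 2) < α) (hα2 : α < 1) (hα0 : α ≠ 0) :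
    (∫ x in Set.Ioi (0:ℝ), x * besselI α (a * x) * (besselK α (a * x)) ^ 3)
    = (π / (8 * a ^ 2)) * (1 / Real.sin (π * α)) *
      (digamma (1 / 2 + α) + 2 * Real.log 2 + Real.eulerMascheroniConstant) := by
  have h := integral_comp_mul_left_Ioi (fun x => x * besselI α x * besselK α x ^ 3) 0 ha
  rw [mul_zero, integral_mul_besselI_mul_besselK_cube hα0 hα1 hα2, digamma_one_half] at h
  have hscale : ∀ x : ℝ, x * besselI α (a * x) * besselK α (a * x) ^ 3
      = a⁻¹ * (a * x * besselI α (a * x) * besselK α (a * x) ^ 3) := fun x => by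
    field_simp
  simp_rw [hscale]
  rw [integral_const_mul, h, smul_eq_mul]
  have hs := sin_pi_mul_sign hα0 (by linarith) hα2
  have hsin : sin (π * α) ≠ 0 := by
    rcases hs with h | h
    exacts [h.2.ne', h.2.ne]
  field_simp
  ring
end
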